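/- arXiv:1307.3602 — 2 statements merged into one kernel-verified Lean document; each statement's English description precedes it below -/
import Mathlib

section
/- There is a class function L : Ord → Ord such that for every uplifting cardinal κ, L maps κ into κ and the restriction L↾κ : κ → κ is an ordinal-anticipating uplifting Laver function for κ: for every ordinal β there are unboundedly many inaccessible cardinals γ > κ admitting a function ℓ* : γ → γ with ⟨V_κ, ∈, L↾κ⟩ ≺ ⟨V_γ, ∈, ℓ*⟩ and ℓ*(κ) = β. -/
open FirstOrder Language

universe u

namespace Paper

/-- The language of set theory: a single binary relation symbol (membership).
We reuse `FirstOrder.Language.graph`, whose sole symbol is a binary relation. -/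
abbrev LSet : FirstOrder.Language := FirstOrder.Language.graph

/-- The rank-initial segment `V_α` of the cumulative hierarchy, realized as the
collection of ZF sets of rank less than `α`. -/
abbrev Vt (α : Ordinal) : Type 1 := {x : ZFSet // x.rank < α}

/-- `V_α` as a structure in the language of set theory, with the membership relation. -/
instance VtStructure (α : Ordinal) : LSet.Structure (Vt α) where
  funMap := fun f _ => f.elim
  RelMap := fun r x => match r with | .adj => (x 0).1 ∈ (x 1).1

/-- The universe of sets as a structure in the language of set theory. -/
instance ZFSetStructure : LSet.Structure ZFSet where
  funMap := fun f _ => f.elim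
  RelMap := fun r x => match r with | .adj => x 0 ∈ x 1

/-- `V_α ≺ V_β`: the inclusion of `V_α` into `V_β` is an elementary embedding. -/
def VElem (α β : Ordinal) : Prop :=
  ∃ e : Vt α ↪ₑ[LSet] Vt β, ∀ x : Vt α, (e x : ZFSet) = x

/-- An ordinal which is a cardinal. -/
def IsCardOrd (γ : Ordinal) : Prop := γ.card.ord = γ

/-- An ordinal which is a regular cardinal. -/
def IsRegularOrd (γ : Ordinal) : Prop := γ.card.IsRegular ∧ γ.card.ord = γ

/-- An ordinal which is an inaccessible cardinal (uncountable, regular, strong limit). -/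
def IsInaccOrd (γ : Ordinal) : Prop := γ.card.IsInaccessible ∧ γ.card.ord = γ

/-- An inaccessible cardinal `κ` is uplifting if for every ordinal `θ` there is an
inaccessible cardinal `γ ≥ θ` such that `V_κ ≺ V_γ` is a proper elementary extension. -/
def IsUplifting (κ : Ordinal) : Prop :=
  IsInaccOrd κ ∧ ∀ θ : Ordinal, ∃ γ : Ordinal, IsInaccOrd γ ∧ θ ≤ γ ∧ κ < γ ∧ VElem κ γ

/-- An inaccessible cardinal `κ` is pseudo uplifting if for every ordinal `θ` there is a
cardinal `γ ≥ θ` such that `V_κ ≺ V_γ` is a proper elementary extension. -/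
def IsPseudoUplifting (κ : Ordinal) : Prop :=
  IsInaccOrd κ ∧ ∀ θ : Ordinal, ∃ γ : Ordinal, IsCardOrd γ ∧ θ ≤ γ ∧ κ < γ ∧ VElem κ γ

/-- Function symbols for the language of set theory with an added unary function symbol. -/
inductive LFFun : ℕ → Type
  | fsym : LFFun 1

/-- Relation symbols for the language of set theory with an added unary function symbol. -/
inductive LFRel : ℕ → Type
  | mem : LFRel 2

/-- The language of set theory augmented by one unary function symbol. -/
def LF : FirstOrder.Language := ⟨LFFun, LFRel⟩

open Classical in
/-- The interpretation on `V_α` of the unary function symbol corresponding to an ordinal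
function `f`: an element coding a von Neumann ordinal `β` is sent to the von Neumann
ordinal coding `f β` (when it lies in `V_α`), and the function is the identity off the
ordinals.  (A von Neumann ordinal is recovered from its rank.) -/
noncomputable def fInterp (α : Ordinal) (f : Ordinal → Ordinal) (x : Vt α) : Vt α :=
  if h : x.1.IsOrdinal ∧ ∃ y : ZFSet, y.IsOrdinal ∧ y.rank = f x.1.rank ∧ y.rank < α then
    ⟨h.2.choose, h.2.choose_spec.2.2⟩
  else x

/-- The structure `⟨V_α, ∈, f⟩` for an ordinal function `f`. -/
noncomputable def LFStructure (α : Ordinal) (f : Ordinal → Ordinal) : LF.Structure (Vt α) where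
  funMap := fun r x => match r with | .fsym => fInterp α f (x 0)
  RelMap := fun r x => match r with | .mem => (x 0).1 ∈ (x 1).1

/-- `⟨V_α, ∈, f⟩ ≺ ⟨V_β, ∈, g⟩`: the inclusion of `V_α` into `V_β` is an elementary
embedding of the expanded structures. -/
def FVElem (α β : Ordinal) (f g : Ordinal → Ordinal) : Prop :=
  letI := LFStructure α f
  letI := LFStructure β g
  ∃ e : Vt α ↪ₑ[LF] Vt β, ∀ x : Vt α, (e x : ZFSet) = x

/-- `f : κ → κ` has the uplifting Menas property for `κ`: for every ordinal `θ` there is an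
inaccessible cardinal `γ ≥ θ` with `κ < γ` and a function `f* : γ → γ` such that
`⟨V_κ, ∈, f⟩ ≺ ⟨V_γ, ∈, f*⟩` and `f*(κ) ≥ θ`. -/
def MenasFor (f : Ordinal → Ordinal) (κ : Ordinal) : Prop :=
  (∀ δ < κ, f δ < κ) ∧
  ∀ θ : Ordinal, ∃ (γ : Ordinal) (g : Ordinal → Ordinal),
    IsInaccOrd γ ∧ θ ≤ γ ∧ κ < γ ∧ (∀ δ < γ, g δ < γ) ∧ FVElem κ γ f g ∧ θ ≤ g κ

/-- `ℓ : κ → κ` is an ordinal-anticipating uplifting Laver function for `κ`: for every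
ordinal `β` there are unboundedly many inaccessible cardinals `γ > κ` admitting a function
`ℓ* : γ → γ` with `⟨V_κ, ∈, ℓ⟩ ≺ ⟨V_γ, ∈, ℓ*⟩` and `ℓ*(κ) = β`. -/
def OrdLaverFor (ℓ : Ordinal → Ordinal) (κ : Ordinal) : Prop :=
  (∀ δ < κ, ℓ δ < κ) ∧
  ∀ (β θ : Ordinal), ∃ (γ : Ordinal) (g : Ordinal → Ordinal),
    IsInaccOrd γ ∧ θ ≤ γ ∧ κ < γ ∧ (∀ δ < γ, g δ < γ) ∧ FVElem κ γ ℓ g ∧ g κ = β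

/-! ### Uniform definability over the levels `V_α` -/

/-- A family of relations on assignments `ℕ → V_α` is uniformly definable if a single formula in
the language of set theory defines it over every `V_α` with `α` inaccessible. -/
def UDef (P : ∀ α : Ordinal, (ℕ → Vt α) → Prop) : Prop :=
  ∃ φ : LSet.Formula ℕ, ∀ α, IsInaccOrd α → ∀ v : ℕ → Vt α, φ.Realize v ↔ P α v

namespace UDef

variable {P Q : ∀ α : Ordinal, (ℕ → Vt α) → Prop}

theorem congr (h : UDef P) (hPQ : ∀ α, IsInaccOrd α → ∀ v, P α v ↔ Q α v) : UDef Q := by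
  obtain ⟨φ, hφ⟩ := h
  exact ⟨φ, fun α hα v => (hφ α hα v).trans (hPQ α hα v)⟩

theorem mem (i j : ℕ) : UDef fun _ v => (v i).1 ∈ (v j).1 := by
  let r : LSet.Relations 2 := Language.adj
  exact ⟨r.formula₂ (Term.var i) (Term.var j), fun α _ v => Formula.realize_rel₂⟩

theorem eq (i j : ℕ) : UDef fun _ v => v i = v j :=
  ⟨Term.equal (Term.var i) (Term.var j), fun α _ v => by simp [Formula.realize_equal]⟩

theorem not (h : UDef P) : UDef fun α v => ¬ P α v := by
  obtain ⟨φ, hφ⟩ := h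
  exact ⟨∼φ, fun α hα v => by rw [Formula.realize_not, hφ α hα]⟩

theorem and (h : UDef P) (h' : UDef Q) : UDef fun α v => P α v ∧ Q α v := by
  obtain ⟨φ, hφ⟩ := h
  obtain ⟨ψ, hψ⟩ := h'
  exact ⟨φ ⊓ ψ, fun α hα v => by rw [Formula.realize_inf, hφ α hα, hψ α hα]⟩

theorem or (h : UDef P) (h' : UDef Q) : UDef fun α v => P α v ∨ Q α v :=
  (h.not.and h'.not).not.congr fun α _ v => by tauto

theorem imp (h : UDef P) (h' : UDef Q) : UDef fun α v => P α v → Q α v :=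
  (h.and h'.not).not.congr fun α _ v => by tauto

theorem iff (h : UDef P) (h' : UDef Q) : UDef fun α v => (P α v ↔ Q α v) :=
  ((h.imp h').and (h'.imp h)).congr fun α _ v => by tauto

theorem all {R : ∀ α : Ordinal, (ℕ → Vt α) → Vt α → Prop}
    (h : UDef fun α w => R α (fun n => w (n + 1)) (w 0)) : UDef fun α v => ∀ a, R α v a := by
  obtain ⟨φ, hφ⟩ := h
  let g : ℕ → ℕ ⊕ Fin 1 := fun n => Nat.casesOn n (Sum.inr 0) Sum.inl
  refine ⟨BoundedFormula.all (BoundedFormula.relabel (n := 1) g φ), fun α hα v => ?_⟩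
  rw [Formula.Realize, BoundedFormula.realize_all]
  refine forall_congr' fun a => ?_
  have key := hφ α hα (fun n => Nat.casesOn n a v)
  refine Iff.trans ?_ key
  refine (BoundedFormula.realize_relabel (m := 1) (n := 0) (φ := φ) (g := g)
    (v := v) (xs := Fin.snoc (α := fun _ => Vt α) default a)).trans ?_
  rw [Formula.Realize]
  have h1 : (Sum.elim v ((Fin.snoc (α := fun _ => Vt α) default a : Fin 1 → Vt α) ∘
      Fin.castAdd 0) ∘ g)
      = fun n => Nat.casesOn n a v := by
    funext n
    cases n <;> rfl
  rw [h1]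
  exact iff_of_eq (congrArg _ (Subsingleton.elim _ _))

theorem ex {R : ∀ α : Ordinal, (ℕ → Vt α) → Vt α → Prop}
    (h : UDef fun α w => R α (fun n => w (n + 1)) (w 0)) : UDef fun α v => ∃ a, R α v a :=
  (all (R := fun α v a => ¬ R α v a) h.not).not.congr fun α _ v => by simp

/-- Uniformly definable relations are absolute along `V_κ ≺ V_γ`. -/
theorem absolute (h : UDef P) {κ γ : Ordinal} (hκ : IsInaccOrd κ) (hγ : IsInaccOrd γ)
    {e : Vt κ ↪ₑ[LSet] Vt γ} (v : ℕ → Vt κ) : P γ (e ∘ v) ↔ P κ v := by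
  obtain ⟨φ, hφ⟩ := h
  rw [← hφ κ hκ, ← hφ γ hγ, e.map_formula]

end UDef

/-! ### Expanding by a uniformly definable ordinal function -/

section Expansion

variable {g : Ordinal → Ordinal → Ordinal}

/-- The graph of the function symbol interpreted by `g α` on `V_α` is uniformly definable. -/
def UDefFun (g : Ordinal → Ordinal → Ordinal) : Prop :=
  ∀ i j, UDef fun α v => v i = fInterp α (g α) (v j)

theorem UDefFun.term (hg : UDefFun g) {A : Type} (t : LF.Term A) :
    ∀ (ρ : A → ℕ) (i : ℕ), UDef fun α v =>
      v i = letI := LFStructure α (g α); t.realize (v ∘ ρ) := by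
  induction t with
  | var a => exact fun ρ i => UDef.eq i (ρ a)
  | @func l f ts ih =>
    intro ρ i
    cases f
    refine ((((hg (i + 1) 0).and (ih 0 (fun a => ρ a + 1) 0)).ex (R := fun α v a =>
      v i = fInterp α (g α) a ∧ a = letI := LFStructure α (g α); (ts 0).realize (v ∘ ρ)))).congr ?_
    intro α _ v
    simp only [exists_eq_right]
    rfl

theorem UDefFun.formula (hg : UDefFun g) {A : Type} {n : ℕ} (φ : LF.BoundedFormula A n) :
    ∀ ρ : A ⊕ Fin n → ℕ, UDef fun α v =>
      letI := LFStructure α (g α); φ.Realize (v ∘ ρ ∘ Sum.inl) (v ∘ ρ ∘ Sum.inr) := by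
  induction φ with
  | falsum =>
    exact fun ρ => ((UDef.eq 0 0).not).congr fun α _ v => by simp [BoundedFormula.Realize]
  | equal t₁ t₂ =>
    intro ρ
    refine (((hg.term t₁ (fun a => ρ a + 1) 0).and (hg.term t₂ (fun a => ρ a + 1) 0)).ex
      (R := fun α v a => a = (letI := LFStructure α (g α); t₁.realize (v ∘ ρ)) ∧
        a = letI := LFStructure α (g α); t₂.realize (v ∘ ρ))).congr fun α _ v => ?_
    simp only [exists_eq_left, BoundedFormula.Realize, ← Function.comp_assoc, Sum.elim_comp_inl_inr]
  | @rel n l r ts =>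
    intro ρ
    cases r
    refine (((((hg.term (ts 0) (fun a => ρ a + 2) 1).and (hg.term (ts 1) (fun a => ρ a + 2) 0)).and
      (UDef.mem 1 0)).ex (R := fun α v b =>
        (v 0 = (letI := LFStructure α (g α); (ts 0).realize (fun a => v (ρ a + 1))) ∧
        b = letI := LFStructure α (g α); (ts 1).realize (fun a => v (ρ a + 1))) ∧
          (v 0).1 ∈ b.1)).ex (R := fun α v a => ∃ b,
        (a = (letI := LFStructure α (g α); (ts 0).realize (v ∘ ρ)) ∧
        b = letI := LFStructure α (g α); (ts 1).realize (v ∘ ρ)) ∧ a.1 ∈ b.1)).congr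
        fun α _ v => ?_
    simp only [BoundedFormula.Realize, ← Function.comp_assoc, Sum.elim_comp_inl_inr]
    constructor
    · rintro ⟨a, b, ⟨rfl, rfl⟩, h⟩
      exact h
    · exact fun h => ⟨_, _, ⟨rfl, rfl⟩, h⟩
  | imp φ ψ ihφ ihψ => exact fun ρ => (ihφ ρ).imp (ihψ ρ)
  | @all n φ ih =>
    intro ρ
    refine ((ih (Sum.elim (fun a => ρ (Sum.inl a) + 1)
      (Fin.snoc (α := fun _ => ℕ) (fun j => ρ (Sum.inr j) + 1) 0))).congr
        (Q := fun α w => letI := LFStructure α (g α);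
          φ.Realize (fun a => w (ρ (Sum.inl a) + 1))
            (Fin.snoc (α := fun _ => Vt α) (fun j => w (ρ (Sum.inr j) + 1)) (w 0)))
        fun α _ w => ?_).all
    refine iff_of_eq ?_
    congr 1
    funext j
    refine Fin.lastCases ?_ (fun j => ?_) j <;> simp

theorem UDefFun.fvElem (hg : UDefFun g) {κ γ : Ordinal} (hκ : IsInaccOrd κ) (hγ : IsInaccOrd γ)
    (h : VElem κ γ) : FVElem κ γ (g κ) (g γ) := by
  obtain ⟨e, he⟩ := h
  let _ := LFStructure κ (g κ)
  let _ := LFStructure γ (g γ)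
  refine ⟨⟨e, fun n φ x => ?_⟩, he⟩
  have hpos : (∅ : ZFSet).rank < κ := by
    rw [ZFSet.rank_empty]
    rcases eq_or_ne κ 0 with rfl | h0
    · have := hκ.1.pos
      simp at this
    · exact pos_iff_ne_zero.2 h0
  let v : ℕ → Vt κ := fun i => if h : i < n then x ⟨i, h⟩ else ⟨∅, hpos⟩
  have key := (hg.formula φ (Sum.elim (fun i => i) Fin.elim0)).absolute hκ hγ (e := e) v
  have hv : v ∘ (fun i : Fin n => (i : ℕ)) = x := by
    funext i
    simp [v]
  have e1 : (v ∘ Sum.elim (fun i : Fin n => (i : ℕ)) Fin.elim0 ∘ Sum.inl) = x := hv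
  have e2 : ((e ∘ v) ∘ Sum.elim (fun i : Fin n => (i : ℕ)) Fin.elim0 ∘ Sum.inl) = e ∘ x := by
    rw [← hv]; rfl
  simp only [e1, e2] at key
  rw [Formula.Realize, Formula.Realize]
  convert key using 2

end Expansion

/-! ### Inaccessible cardinals and the levels `V_γ` -/

open Ordinal Cardinal ZFSet

namespace IsInaccOrd

variable {γ : Ordinal.{0}}

theorem omega0_lt (h : IsInaccOrd γ) : ω < γ := by
  rw [← h.2, Cardinal.lt_ord, card_omega0]
  exact h.1.aleph0_lt

theorem isSuccLimit (h : IsInaccOrd γ) : Order.IsSuccLimit γ := by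
  rw [← h.2]
  exact Cardinal.isSuccLimit_ord h.1.aleph0_lt.le

theorem add_one_lt (h : IsInaccOrd γ) {o : Ordinal} (ho : o < γ) : o + 1 < γ :=
  h.isSuccLimit.succ_lt ho

theorem pos (h : IsInaccOrd γ) : 0 < γ :=
  omega0_pos.trans h.omega0_lt

theorem card_lt (h : IsInaccOrd γ) {x : ZFSet} (hx : x.rank < γ) : x.card < γ.card := by
  calc x.card ≤ (V_ x.rank).card := card_mono (subset_vonNeumann.2 le_rfl)
    _ = preBeth x.rank := card_vonNeumann _
    _ < preBeth γ := preBeth_strictMono hx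
    _ = γ.card := by conv_lhs => rw [← h.2, h.1.preBeth_ord]

/-- A family of ordinals below `γ` indexed by an element of `V_γ` is bounded below `γ`. -/
theorem exists_bound (h : IsInaccOrd γ) {x : ZFSet} (hx : x.rank < γ) (f : ZFSet → Ordinal)
    (hf : ∀ i ∈ x, f i < γ) : ∃ μ < γ, ∀ i ∈ x, f i < μ := by
  have hsm : Cardinal.mk (f '' {i | i ∈ x} : Set Ordinal) < (Ordinal.lift.{1} γ).cof := by
    refine Cardinal.mk_image_le.trans_lt ?_
    change Cardinal.mk (x : Type 1) < _
    rw [cardinalMk_coe_sort, ← lift_cof, Cardinal.lift_lt]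
    refine (h.card_lt hx).trans_le ?_
    conv_rhs => rw [← h.2]
    exact h.1.le_cof_ord
  have hle : ∀ o ∈ f '' {i | i ∈ x}, o < γ := by
    rintro _ ⟨i, hi, rfl⟩
    exact hf i hi
  refine ⟨_, sSup_add_one_lt_of_lt_cof hsm hle, fun i hi => ?_⟩
  have hb : BddAbove ((fun o : Ordinal => o + 1) '' (f '' {i | i ∈ x})) := by
    refine ⟨γ, ?_⟩
    rintro _ ⟨o, ho, rfl⟩
    exact (h.add_one_lt (hle o ho)).le
  exact lt_of_lt_of_le (lt_add_one _) (le_csSup hb ⟨_, ⟨i, hi, rfl⟩, rfl⟩)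

/-- A characterization of inaccessibility by boundedness of sets injecting into an element
of `V_γ`. -/
theorem of_bounded (hω : ω < γ) (hlim : ∀ o < γ, o + 1 < γ)
    (h : ∀ x : ZFSet, x.rank < γ → ∀ s : Set Ordinal, s ⊆ Set.Iio γ →
      Cardinal.mk s ≤ Cardinal.mk (x : Type 1) → ∃ μ < γ, ∀ i ∈ s, i < μ) : IsInaccOrd γ := by
  have hpow : ∀ o < γ, 2 ^ o.card < γ.card := by
    intro o ho
    by_contra! hc
    obtain ⟨μ, hμ, hb⟩ := h (powerset o.toZFSet)
      (by rw [rank_powerset, rank_toZFSet]; exact hlim o ho) (Set.Iio γ) subset_rfl (by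
        rw [cardinalMk_coe_sort, card_powerset, card_toZFSet, Cardinal.mk_Iio_ordinal]
        exact Cardinal.lift_le.2 hc)
    exact (hb μ hμ).false
  have hcard : γ.card.ord = γ := by
    refine le_antisymm (ord_card_le γ) (le_of_forall_lt fun o ho => ?_)
    rw [Cardinal.lt_ord]
    exact (Cardinal.cantor _).trans (hpow o ho)
  refine ⟨⟨?_, ?_, fun c hc => ?_⟩, hcard⟩
  · rw [← card_omega0, ← Cardinal.lt_ord, hcard]
    exact hω
  · rw [hcard]
    by_contra! hc
    obtain ⟨s, hs, hs'⟩ := Order.exists_cof_eq (Set.Iio γ)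
    have hc' : γ.cof.ord < γ := by
      conv_rhs => rw [← hcard]
      exact Cardinal.ord_lt_ord.2 hc
    obtain ⟨μ, hμ, hb⟩ := h γ.cof.ord.toZFSet (by rwa [rank_toZFSet]) (Subtype.val '' s)
      (by rintro _ ⟨i, _, rfl⟩; exact i.2) (by
        rw [cardinalMk_coe_sort, card_toZFSet, card_ord]
        refine Cardinal.mk_image_le.trans ?_
        rw [hs', Ordinal.cof_Iio, lift_cof])
    obtain ⟨i, hi, hle⟩ := hs ⟨μ, hμ⟩
    exact (hb i ⟨i, hi, rfl⟩).not_ge hle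
  · have := hpow c.ord (by rw [← hcard]; exact Cardinal.ord_lt_ord.2 hc)
    rwa [card_ord] at this

end IsInaccOrd

/-- First-order closure properties characterizing the levels `V_γ` with `γ` inaccessible. -/
def IsUniv (C : ZFSet.{0}) : Prop :=
  (∀ x ∈ C, ∀ y ∈ x, y ∈ C) ∧
  (∀ x ∈ C, ∃ p ∈ C, ∀ y : ZFSet.{0}, y ⊆ x → y ∈ p) ∧
  (∀ x ∈ C, ∃ u ∈ C, ∀ y ∈ x, ∀ z ∈ y, z ∈ u) ∧
  (∃ w ∈ C, (∃ x, x ∈ w) ∧ ∀ x ∈ w, ∃ y ∈ w, x ∈ y) ∧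
  (∀ x ∈ C, ∀ f : ZFSet.{0}, (∀ i ∈ x, ∀ a ∈ C, ∀ b ∈ C, pair i a ∈ f → pair i b ∈ f → a = b) →
    ∃ r ∈ C, ∀ i ∈ x, ∀ a ∈ C, pair i a ∈ f → a ∈ r)

theorem isUniv_vonNeumann {γ : Ordinal.{0}} (h : IsInaccOrd γ) : IsUniv (V_ γ) := by
  refine ⟨fun x hx y hy => ?_, fun x hx => ⟨powerset x, ?_, fun y hy => mem_powerset.2 hy⟩,
    fun x hx => ⟨⋃₀ x, ?_, fun y hy z hz => mem_sUnion.2 ⟨y, hy, hz⟩⟩, ⟨V_ ω, ?_, ⟨∅, ?_⟩,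
      fun x hx => ⟨{x}, ?_, mem_singleton.2 rfl⟩⟩, fun x hx f hf => ?_⟩
  · rw [mem_vonNeumann] at *
    exact (rank_lt_of_mem hy).trans hx
  · rw [mem_vonNeumann] at *
    rw [rank_powerset]
    exact h.add_one_lt hx
  · rw [mem_vonNeumann] at *
    exact (rank_sUnion_le x).trans_lt hx
  · rw [mem_vonNeumann, rank_vonNeumann]
    exact h.omega0_lt
  · rw [mem_vonNeumann, rank_empty]
    exact omega0_pos
  · rw [mem_vonNeumann] at *
    rw [rank_singleton]
    exact isSuccLimit_omega0.succ_lt hx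
  · classical
    let F : ZFSet → Ordinal := fun i =>
      if h : ∃ a ∈ V_ γ, pair i a ∈ f then h.choose.rank else 0
    obtain ⟨μ, hμ, hb⟩ := h.exists_bound (mem_vonNeumann.1 hx) F fun i _ => by
      by_cases h' : ∃ a ∈ V_ γ, pair i a ∈ f
      · simpa only [F, dif_pos h'] using mem_vonNeumann.1 h'.choose_spec.1
      · simpa only [F, dif_neg h'] using h.pos
    refine ⟨V_ μ, by rwa [mem_vonNeumann, rank_vonNeumann], fun i hi a ha hia => ?_⟩
    have h' : ∃ a ∈ V_ γ, pair i a ∈ f := ⟨a, ha, hia⟩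
    have := hb i hi
    simp only [F, dif_pos h'] at this
    rw [hf i hi a ha _ h'.choose_spec.1 hia h'.choose_spec.2]
    exact mem_vonNeumann.2 this

theorem IsUniv.exists_eq {C : ZFSet.{0}} (h : IsUniv C) :
    ∃ γ, IsInaccOrd γ ∧ C = V_ γ := by
  obtain ⟨htr, hpow, hun, ⟨w, hw, ⟨x₀, hx₀⟩, hsucc⟩, hrep⟩ := h
  have hsub : ∀ x ∈ C, ∀ y, y ⊆ x → y ∈ C := fun x hx y hy => by
    obtain ⟨p, hp, hp'⟩ := hpow x hx
    exact htr p hp y (hp' y hy)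
  have hpow' : ∀ x ∈ C, powerset x ∈ C := fun x hx => by
    obtain ⟨p, hp, hp'⟩ := hpow x hx
    exact hsub p hp _ fun y hy => hp' y (mem_powerset.1 hy)
  have hV : ∀ x, x ∈ C → V_ x.rank ∈ C := by
    intro x
    induction x using ZFSet.inductionOn with
    | _ x ih =>
    intro hx
    let f := range fun y : x => pair y.1 (powerset (V_ y.1.rank))
    have hf : ∀ i a, pair i a ∈ f → a = powerset (V_ i.rank) := by
      intro i a hia
      obtain ⟨y, hy⟩ := mem_range.1 hia
      obtain ⟨rfl, rfl⟩ := pair_inj.1 hy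
      rfl
    obtain ⟨r, hr, hr'⟩ := hrep x hx f fun i _ a _ b _ ha hb => by rw [hf i a ha, hf i b hb]
    obtain ⟨u, hu, hu'⟩ := hun r hr
    refine hsub u hu _ fun z hz => ?_
    obtain ⟨y, hy, hzy⟩ := lt_rank_iff.1 (mem_vonNeumann.1 hz)
    exact hu' _ (hr' y hy _ (hpow' _ (ih y hy (htr x hx y hy))) (mem_range.2 ⟨⟨y, hy⟩, rfl⟩)) z
      (mem_powerset.2 (subset_vonNeumann.2 hzy))
  have hC : ∀ x, x.rank < C.rank → x ∈ C := fun x hx => by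
    obtain ⟨y, hy, hxy⟩ := lt_rank_iff.1 hx
    exact hsub _ (hV y hy) x (subset_vonNeumann.2 hxy)
  refine ⟨C.rank, IsInaccOrd.of_bounded ?_ (fun o ho => ?_) fun x hx s hs hle => ?_, ?_⟩
  · refine lt_of_le_of_lt (le_of_forall_lt fun o ho => ?_) (rank_lt_of_mem hw)
    obtain ⟨n, rfl⟩ := lt_omega0.1 ho
    have : ∃ x ∈ w, (n : Ordinal) ≤ x.rank := by
      clear ho
      induction n with
      | zero => exact ⟨x₀, hx₀, by simp⟩
      | succ n ih =>
        obtain ⟨x, hx, hn⟩ := ih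
        obtain ⟨y, hy, hxy⟩ := hsucc x hx
        refine ⟨y, hy, ?_⟩
        push_cast
        exact Order.add_one_le_of_lt (hn.trans_lt (rank_lt_of_mem hxy))
    obtain ⟨x, hx, hn⟩ := this
    exact hn.trans_lt (rank_lt_of_mem hx)
  · obtain ⟨y, hy, hoy⟩ := lt_rank_iff.1 ho
    have := rank_lt_of_mem (hpow' y hy)
    rw [rank_powerset] at this
    exact (Order.succ_le_succ hoy).trans_lt this
  · obtain ⟨e⟩ := hle
    have : Small.{0} s := small_of_injective e.injective
    let f := range fun a : s => pair (e a).1 a.1.toZFSet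
    obtain ⟨r, hr, hr'⟩ := hrep x (hC x hx) f fun i _ a _ b _ ha hb => by
      obtain ⟨c, hc⟩ := mem_range.1 ha
      obtain ⟨d, hd⟩ := mem_range.1 hb
      obtain ⟨rfl, rfl⟩ := pair_inj.1 hc
      obtain ⟨hdc, rfl⟩ := pair_inj.1 hd
      rw [e.injective (Subtype.ext hdc)]
    refine ⟨r.rank, rank_lt_of_mem hr, fun i hi => ?_⟩
    have := rank_lt_of_mem (hr' (e ⟨i, hi⟩).1 (e ⟨i, hi⟩).2 i.toZFSet
      (hC _ (by rw [rank_toZFSet]; exact hs hi)) (mem_range.2 ⟨⟨i, hi⟩, rfl⟩))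
    rwa [rank_toZFSet] at this
  · ext x
    rw [mem_vonNeumann]
    exact ⟨rank_lt_of_mem, hC x⟩

/-! ### Uniform definability of basic set-theoretic notions -/

namespace UDef

theorem eq_val (i j : ℕ) : UDef fun _ v => (v i).1 = (v j).1 :=
  (UDef.eq i j).congr fun _ _ _ => Subtype.ext_iff

theorem ball {R : ∀ α : Ordinal, (ℕ → Vt α) → ZFSet → Prop} {j : ℕ}
    (h : UDef fun α w => R α (fun n => w (n + 1)) (w 0).1) :
    UDef fun α v => ∀ x ∈ (v j).1, R α v x :=
  (all (R := fun α v a => a.1 ∈ (v j).1 → R α v a.1) ((mem 0 (j + 1)).imp h)).congr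
    fun _ _ v => ⟨fun H x hx => H ⟨x, (rank_lt_of_mem hx).trans (v j).2⟩ hx,
      fun H a ha => H a.1 ha⟩

theorem bex {R : ∀ α : Ordinal, (ℕ → Vt α) → ZFSet → Prop} {j : ℕ}
    (h : UDef fun α w => R α (fun n => w (n + 1)) (w 0).1) :
    UDef fun α v => ∃ x ∈ (v j).1, R α v x :=
  (ball (R := fun α v a => ¬ R α v a) (j := j) h.not).not.congr fun α _ v => by simp

theorem subset (i j : ℕ) : UDef fun _ v => (v i).1 ⊆ (v j).1 :=
  ball (R := fun _ v x => x ∈ (v j).1) (mem 0 (j + 1))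

theorem eq_empty (i : ℕ) : UDef fun _ v => (v i).1 = ∅ :=
  (ball (j := i) (R := fun _ v x => x ≠ x) (eq_val 0 0).not).congr fun _ _ v => by
    simp [ZFSet.eq_empty]

theorem eq_pair_set (i j k : ℕ) : UDef fun _ v => (v i).1 = {(v j).1, (v k).1} := by
  refine UDef.congr (P := fun _ v => (v j).1 ∈ (v i).1 ∧ (v k).1 ∈ (v i).1 ∧
    ∀ x ∈ (v i).1, x = (v j).1 ∨ x = (v k).1) ?_ fun α _ v => ?_
  · refine (mem _ _).and ((mem _ _).and ?_)
    apply ball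
    exact (eq_val 0 (j + 1)).or (eq_val 0 (k + 1))
  · constructor
    · rintro ⟨h₁, h₂, h₃⟩
      ext x
      rw [mem_pair]
      refine ⟨h₃ x, ?_⟩
      rintro (rfl | rfl) <;> assumption
    · intro h
      simp [h]

theorem pair_mem (i j k : ℕ) : UDef fun _ v => pair (v i).1 (v j).1 ∈ (v k).1 := by
  refine UDef.congr (P := fun _ v => ∃ p ∈ (v k).1, ∃ s ∈ p, s = {(v i).1, (v i).1} ∧
    ∃ t ∈ p, t = {(v i).1, (v j).1} ∧ p = {s, t}) ?_ fun α _ v => ?_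
  · apply bex
    refine bex (j := 0) (R := fun _ v s => s = {(v (i + 1)).1, (v (i + 1)).1} ∧
      ∃ t ∈ (v 0).1, t = {(v (i + 1)).1, (v (j + 1)).1} ∧ (v 0).1 = {s, t}) ?_
    refine (eq_pair_set _ _ _).and ?_
    refine bex (j := 1) (R := fun _ v t => t = {(v (i + 2)).1, (v (j + 2)).1} ∧
      (v 1).1 = {(v 0).1, t}) ?_
    exact (eq_pair_set 0 (i + 3) (j + 3)).and (eq_pair_set 2 1 0)
  · have hs : ∀ x : ZFSet.{0}, ({x, x} : ZFSet) = {x} := fun x => by ext; simp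
    constructor
    · rintro ⟨p, hp, s, hs', rfl, t, ht, rfl, rfl⟩
      rwa [pair, ← hs]
    · intro h
      refine ⟨_, h, {(v i).1, (v i).1}, ?_, rfl, {(v i).1, (v j).1}, ?_, rfl, ?_⟩ <;>
        simp [pair, hs]

theorem isOrdinal (i : ℕ) : UDef fun _ v => (v i).1.IsOrdinal := by
  refine UDef.congr (P := fun _ v => (∀ x ∈ (v i).1, x ⊆ (v i).1) ∧
    ∀ z ∈ (v i).1, ∀ y ∈ z, ∀ x ∈ y, x ∈ z) ?_ fun α _ v => ?_
  · refine and ?_ ?_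
    · apply ball
      exact subset 0 (i + 1)
    · apply ball
      apply ball (j := 0) (R := fun _ w y => ∀ x ∈ y, x ∈ (w 0).1)
      apply ball (j := 0) (R := fun _ w x => x ∈ (w 1).1)
      exact mem 0 2
  · exact ⟨fun h => ⟨fun x hx => h.1 x hx, fun hxy hyz hz => h.2 _ hz _ hyz _ hxy⟩,
      fun h => ⟨fun x hx => h.1 x hx, fun z hz y hy x hx => h.mem_trans' hx hy hz⟩⟩

end UDef

theorem rank_kpair_le (x y : ZFSet.{0}) :
    (pair x y).rank ≤ Order.succ (Order.succ (max x.rank y.rank)) := by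
  rw [pair, ZFSet.rank_pair, rank_singleton, ZFSet.rank_pair, ← Order.succ_max, ← Order.succ_max]
  simp

theorem IsInaccOrd.rank_lt_of_pairs {α μ : Ordinal.{0}} (hα : IsInaccOrd α) (hμ : μ < α)
    {t : ZFSet} (ht : ∀ p ∈ t, ∃ x y, x.rank ≤ μ ∧ y.rank ≤ μ ∧ p = pair x y) : t.rank < α := by
  refine lt_of_le_of_lt (rank_le_iff.2 fun p hp => ?_)
    (hα.add_one_lt (hα.add_one_lt (hα.add_one_lt hμ)))
  obtain ⟨x, y, hx, hy, rfl⟩ := ht p hp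
  exact (rank_kpair_le x y).trans_lt (Order.lt_succ_of_le
    (Order.succ_le_succ (Order.succ_le_succ (max_le hx hy))))

namespace UDef

theorem isUniv (i : ℕ) : UDef fun _ v => IsUniv (v i).1 := by
  refine UDef.congr (P := fun α v =>
    (∀ x ∈ (v i).1, ∀ y ∈ x, y ∈ (v i).1) ∧
    (∀ x ∈ (v i).1, ∃ p ∈ (v i).1, ∀ y : Vt α, y.1 ⊆ x → y.1 ∈ p) ∧
    (∀ x ∈ (v i).1, ∃ u ∈ (v i).1, ∀ y ∈ x, ∀ z ∈ y, z ∈ u) ∧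
    (∃ w ∈ (v i).1, (∃ x ∈ w, x = x) ∧ ∀ x ∈ w, ∃ y ∈ w, x ∈ y) ∧
    (∀ x ∈ (v i).1, ∀ f : Vt α, (∀ i' ∈ x, ∀ a ∈ (v i).1, ∀ b ∈ (v i).1, pair i' a ∈ f.1 →
      pair i' b ∈ f.1 → a = b) →
      ∃ r ∈ (v i).1, ∀ i' ∈ x, ∀ a ∈ (v i).1, pair i' a ∈ f.1 → a ∈ r)) ?_ fun α hα v => ?_
  · repeat' first
      | exact UDef.mem _ _
      | exact UDef.subset _ _
      | exact UDef.eq_val _ _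
      | exact UDef.pair_mem _ _ _
      | apply UDef.ball
      | apply UDef.bex
      | apply UDef.and
      | apply UDef.imp
      | apply UDef.all
  · have hlt : ∀ {x y : ZFSet}, x ∈ y → y.rank < α → x.rank < α :=
      fun hx hy => (rank_lt_of_mem hx).trans hy
    refine and_congr_right fun _ => and_congr ?_ <| and_congr_right fun _ =>
      and_congr (by simp only [and_true]) ?_
    · refine forall₂_congr fun x hx => exists_congr fun p => and_congr_right fun _ =>
        ⟨fun H y hy => H ⟨y, ?_⟩ hy, fun H y hy => H y.1 hy⟩
      exact (rank_mono hy).trans_lt (hlt hx (v i).2)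
    · refine forall₂_congr fun x hx => ⟨fun H f hf => ?_, fun H f => H f.1⟩
      let g : ZFSet := ZFSet.sep (fun p => p ∈ f) (prod x (v i).1)
      have hg : g.rank < α := by
        refine hα.rank_lt_of_pairs (v i).2 fun p hp => ?_
        obtain ⟨a, ha, b, hb, rfl⟩ := mem_prod.1 (mem_sep.1 hp).1
        exact ⟨a, b, ((rank_lt_of_mem ha).trans (rank_lt_of_mem hx)).le,
          (rank_lt_of_mem hb).le, rfl⟩
      obtain ⟨r, hr, hr'⟩ := H ⟨g, hg⟩ fun j hj a ha b hb h₁ h₂ =>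
        hf j hj a ha b hb (mem_sep.1 h₁).2 (mem_sep.1 h₂).2
      exact ⟨r, hr, fun j hj a ha h => hr' j hj a ha (mem_sep.2 ⟨pair_mem_prod.2 ⟨hj, ha⟩, h⟩)⟩

end UDef

/-! ### Uniform definability of elementarity between levels -/

theorem UDef.ball_subset {R : ∀ α : Ordinal, (ℕ → Vt α) → ZFSet → Prop} {j : ℕ}
    (h : UDef fun α w => R α (fun n => w (n + 1)) (w 0).1) :
    UDef fun α v => ∀ x ⊆ (v j).1, R α v x :=
  (all (R := fun α v a => a.1 ⊆ (v j).1 → R α v a.1) ((subset 0 (j + 1)).imp h)).congr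
    fun _ _ v => ⟨fun H x hx => H ⟨x, (rank_mono hx).trans_lt (v j).2⟩ hx,
      fun H a ha => H a.1 ha⟩

theorem UDef.bex_subset {R : ∀ α : Ordinal, (ℕ → Vt α) → ZFSet → Prop} {j : ℕ}
    (h : UDef fun α w => R α (fun n => w (n + 1)) (w 0).1) :
    UDef fun α v => ∃ x ⊆ (v j).1, R α v x :=
  (ball_subset (R := fun α v a => ¬ R α v a) (j := j) h.not).not.congr fun α _ v => by simp

/-- `t` codes an assignment of elements of `C` to variables indexed by the elements of `D`. -/
def IsAssign (D C t : ZFSet.{0}) : Prop :=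
  ∀ i ∈ D, ∃ a ∈ C, pair i a ∈ t ∧ ∀ b ∈ C, pair i b ∈ t → b = a

/-- The assignments `s` and `t` agree on all variables other than `i`. -/
def AgreeOff (D C i s t : ZFSet.{0}) : Prop :=
  ∀ j ∈ D, j ≠ i → ∀ a ∈ C, pair j a ∈ s → pair j a ∈ t

/-- `G` is a family of sets of assignments containing all first-order definable ones and
satisfying the Tarski-Vaught criterion for `D ⊆ C`. -/
def IsElemWitness (D C G : ZFSet.{0}) : Prop :=
  (∃ Z ∈ G, ∀ s ⊆ C, IsAssign D C s → s ∉ Z) ∧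
  (∀ i ∈ D, ∀ j ∈ D, ∃ Z ∈ G, ∀ s ⊆ C, IsAssign D C s →
    (s ∈ Z ↔ ∃ a ∈ C, pair i a ∈ s ∧ pair j a ∈ s)) ∧
  (∀ i ∈ D, ∀ j ∈ D, ∃ Z ∈ G, ∀ s ⊆ C, IsAssign D C s →
    (s ∈ Z ↔ ∃ a ∈ C, ∃ b ∈ C, pair i a ∈ s ∧ pair j b ∈ s ∧ a ∈ b)) ∧
  (∀ X ∈ G, ∀ Y ∈ G, ∃ Z ∈ G, ∀ s ⊆ C, IsAssign D C s → (s ∈ Z ↔ (s ∈ X → s ∈ Y))) ∧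
  (∀ X ∈ G, ∀ i ∈ D, ∃ Z ∈ G, ∀ s ⊆ C, IsAssign D C s →
    (s ∈ Z ↔ ∀ t ⊆ C, IsAssign D C t → AgreeOff D C i s t → t ∈ X)) ∧
  (∀ X ∈ G, ∀ s ⊆ C, IsAssign D C s → (∀ i ∈ D, ∀ a ∈ C, pair i a ∈ s → a ∈ D) →
    ∀ i ∈ D, (∃ t ⊆ C, IsAssign D C t ∧ AgreeOff D C i s t ∧ t ∈ X) →
      ∃ t ⊆ C, IsAssign D C t ∧ AgreeOff D C i s t ∧ t ∈ X ∧ ∀ a ∈ C, pair i a ∈ t → a ∈ D)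

theorem UDef.isAssign (i j k : ℕ) : UDef fun _ v => IsAssign (v i).1 (v j).1 (v k).1 := by
  unfold IsAssign
  repeat' first
    | exact UDef.eq_val _ _
    | exact UDef.pair_mem _ _ _
    | apply UDef.ball
    | apply UDef.bex
    | apply UDef.and
    | apply UDef.imp

theorem UDef.agreeOff (i j k l m : ℕ) :
    UDef fun _ v => AgreeOff (v i).1 (v j).1 (v k).1 (v l).1 (v m).1 := by
  unfold AgreeOff
  repeat' first
    | exact (UDef.eq_val _ _).not
    | exact UDef.pair_mem _ _ _
    | apply UDef.ball
    | apply UDef.imp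

theorem UDef.isElemWitness (i j k : ℕ) :
    UDef fun _ v => IsElemWitness (v i).1 (v j).1 (v k).1 := by
  unfold IsElemWitness
  repeat' first
    | exact UDef.mem _ _
    | exact (UDef.mem _ _).not
    | exact UDef.pair_mem _ _ _
    | exact UDef.isAssign _ _ _
    | exact UDef.agreeOff _ _ _ _ _
    | apply UDef.ball_subset
    | apply UDef.bex_subset
    | apply UDef.ball
    | apply UDef.bex
    | apply UDef.and
    | apply UDef.iff
    | apply UDef.imp

section Codes

variable {δ γ : Ordinal.{0}}

/-- The set `t` codes the graph of `f : V_δ → V_γ`. -/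
def Codes (t : ZFSet.{0}) (f : Vt δ → Vt γ) : Prop :=
  ∀ i a, pair i.1 a.1 ∈ t ↔ a = f i

theorem Vt.mem (x : Vt γ) : x.1 ∈ V_ γ := mem_vonNeumann.2 x.2

theorem IsAssign.exists_codes {t : ZFSet.{0}} (h : IsAssign (V_ δ) (V_ γ) t) :
    ∃ f : Vt δ → Vt γ, Codes t f := by
  choose! g hg hgt hgu using h
  refine ⟨fun i => ⟨g i.1, mem_vonNeumann.1 (hg _ i.mem)⟩, fun i a => ⟨fun h => ?_, ?_⟩⟩
  · exact Subtype.ext (hgu i.1 i.mem a.1 a.mem h)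
  · rintro rfl
    exact hgt i.1 i.mem

theorem Codes.isAssign {t : ZFSet.{0}} {f : Vt δ → Vt γ} (h : Codes t f) :
    IsAssign (V_ δ) (V_ γ) t := fun i hi => by
  refine ⟨(f ⟨i, mem_vonNeumann.1 hi⟩).1, Vt.mem _, (h ⟨i, _⟩ _).2 rfl, fun b hb hbt => ?_⟩
  exact congrArg Subtype.val ((h ⟨i, _⟩ ⟨b, mem_vonNeumann.1 hb⟩).1 hbt)

theorem Codes.inj {t : ZFSet.{0}} {f g : Vt δ → Vt γ} (hf : Codes t f) (hg : Codes t g) :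
    f = g := funext fun i => (hg i (f i)).1 ((hf i (f i)).2 rfl)

theorem exists_codes (hγ : IsInaccOrd γ) (hδ : δ ≤ γ) (f : Vt δ → Vt γ) :
    ∃ t ⊆ V_ γ, Codes t f := by
  refine ⟨ZFSet.sep (fun p => ∃ i, p = pair i.1 (f i).1) (V_ γ), sep_subset, fun i a => ?_⟩
  rw [mem_sep]
  constructor
  · rintro ⟨-, j, hj⟩
    obtain ⟨h₁, h₂⟩ := pair_inj.1 hj
    rw [Subtype.ext h₁, Subtype.ext h₂]
  · rintro rfl
    refine ⟨mem_vonNeumann.2 ((rank_kpair_le _ _).trans_lt ?_), i, rfl⟩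
    exact hγ.add_one_lt (hγ.add_one_lt (max_lt (i.2.trans_le hδ) (f i).2))

theorem Codes.agreeOff_iff [DecidableEq (Vt δ)] {s t : ZFSet.{0}} {f g : Vt δ → Vt γ}
    (hs : Codes s f) (ht : Codes t g)
    (i : Vt δ) : AgreeOff (V_ δ) (V_ γ) i.1 s t ↔ ∃ a, g = Function.update f i a := by
  constructor
  · refine fun h => ⟨g i, funext fun j => ?_⟩
    by_cases hj : j = i
    · subst hj
      simp
    · rw [Function.update_of_ne hj]
      exact ((ht j (f j)).1 (h j.1 j.mem (fun h => hj (Subtype.ext h)) _ (f j).mem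
        ((hs j (f j)).2 rfl))).symm
  · rintro ⟨b, rfl⟩ j hj hji a ha h
    let j' : Vt δ := ⟨j, mem_vonNeumann.1 hj⟩
    have h' := (hs j' ⟨a, mem_vonNeumann.1 ha⟩).1 h
    refine (ht j' ⟨a, mem_vonNeumann.1 ha⟩).2 ?_
    rw [Function.update_of_ne (fun h => hji (congrArg Subtype.val h)), h']

/-- Universal quantification over one free variable. -/
theorem exists_formula_forall {A : Type*} [DecidableEq A] (φ : LSet.Formula A) (i : A) :
    ∃ ψ : LSet.Formula A, ∀ (M : Type 1) [LSet.Structure M] (f : A → M),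
      ψ.Realize f ↔ ∀ a, φ.Realize (Function.update f i a) := by
  let g : A → A ⊕ Fin 1 := fun j => if j = i then Sum.inr 0 else Sum.inl j
  refine ⟨BoundedFormula.all (BoundedFormula.relabel (n := 1) g φ), fun M _ f => ?_⟩
  rw [Formula.Realize, BoundedFormula.realize_all]
  refine forall_congr' fun a => ?_
  refine (BoundedFormula.realize_relabel (m := 1) (n := 0) (φ := φ) (g := g)
    (v := f) (xs := Fin.snoc (α := fun _ => M) default a)).trans ?_
  rw [Formula.Realize]
  have h1 : (Sum.elim f ((Fin.snoc (α := fun _ => M) default a : Fin 1 → M) ∘ Fin.castAdd 0) ∘ g)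
      = Function.update f i a := by
    funext j
    by_cases hj : j = i
    · subst hj
      simp [g]
      rfl
    · simp [g, hj]
  rw [h1]
  exact iff_of_eq (congrArg _ (Subsingleton.elim _ _))

theorem exists_isElemWitness (hγ : IsInaccOrd γ) (hδ : δ ≤ γ) (h : VElem δ γ) :
    ∃ G ⊆ powerset (powerset (V_ γ)), IsElemWitness (V_ δ) (V_ γ) G := by
  classical
  obtain ⟨e, he⟩ := h
  let Def : ZFSet → LSet.Formula (Vt δ) → Prop := fun X φ =>
    ∀ t ⊆ V_ γ, ∀ f : Vt δ → Vt γ, Codes t f → (t ∈ X ↔ φ.Realize f)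
  let G := ZFSet.sep (fun X => ∃ φ, Def X φ) (powerset (powerset (V_ γ)))
  have hex : ∀ φ, ∃ X ∈ G, Def X φ := by
    intro φ
    let X := ZFSet.sep (fun t => ∃ f : Vt δ → Vt γ, Codes t f ∧ φ.Realize f) (powerset (V_ γ))
    have hX : Def X φ := fun t ht f hf => by
      rw [mem_sep, mem_powerset]
      constructor
      · rintro ⟨-, g, hg, h⟩
        rwa [hf.inj hg]
      · exact fun h => ⟨ht, f, hf, h⟩
    exact ⟨X, mem_sep.2 ⟨mem_powerset.2 sep_subset, φ, hX⟩, hX⟩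
  have hG : ∀ X ∈ G, ∃ φ, Def X φ := fun X hX => (mem_sep.1 hX).2
  refine ⟨G, sep_subset, ?_, ?_, ?_, ?_, ?_, ?_⟩
  · obtain ⟨Z, hZ, hZ'⟩ := hex ⊥
    refine ⟨Z, hZ, fun s hs ha => ?_⟩
    obtain ⟨f, hf⟩ := ha.exists_codes
    rw [hZ' s hs f hf]
    exact id
  · intro i hi j hj
    lift i to Vt δ using mem_vonNeumann.1 hi
    lift j to Vt δ using mem_vonNeumann.1 hj
    obtain ⟨Z, hZ, hZ'⟩ := hex (Term.equal (Term.var i) (Term.var j))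
    refine ⟨Z, hZ, fun s hs ha => ?_⟩
    obtain ⟨f, hf⟩ := ha.exists_codes
    rw [hZ' s hs f hf, Formula.realize_equal]
    constructor
    · intro h
      exact ⟨(f i).1, (f i).mem, (hf i _).2 rfl, (hf j _).2 h⟩
    · rintro ⟨a, ha, h₁, h₂⟩
      exact ((hf i ⟨a, mem_vonNeumann.1 ha⟩).1 h₁).symm.trans
        ((hf j ⟨a, mem_vonNeumann.1 ha⟩).1 h₂)
  · intro i hi j hj
    lift i to Vt δ using mem_vonNeumann.1 hi
    lift j to Vt δ using mem_vonNeumann.1 hj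
    let r : LSet.Relations 2 := Language.adj
    obtain ⟨Z, hZ, hZ'⟩ := hex (r.formula₂ (Term.var i) (Term.var j))
    refine ⟨Z, hZ, fun s hs ha => ?_⟩
    obtain ⟨f, hf⟩ := ha.exists_codes
    rw [hZ' s hs f hf, Formula.realize_rel₂]
    change (f i).1 ∈ (f j).1 ↔ _
    constructor
    · intro h
      exact ⟨(f i).1, (f i).mem, (f j).1, (f j).mem, (hf i _).2 rfl, (hf j _).2 rfl, h⟩
    · rintro ⟨a, ha, b, hb, h₁, h₂, h⟩
      have e₁ := congrArg Subtype.val ((hf i ⟨a, mem_vonNeumann.1 ha⟩).1 h₁)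
      have e₂ := congrArg Subtype.val ((hf j ⟨b, mem_vonNeumann.1 hb⟩).1 h₂)
      dsimp only at e₁ e₂
      rwa [← e₁, ← e₂]
  · intro X hX Y hY
    obtain ⟨φ, hφ⟩ := hG X hX
    obtain ⟨ψ, hψ⟩ := hG Y hY
    obtain ⟨Z, hZ, hZ'⟩ := hex (φ.imp ψ)
    refine ⟨Z, hZ, fun s hs ha => ?_⟩
    obtain ⟨f, hf⟩ := ha.exists_codes
    rw [hZ' s hs f hf, hφ s hs f hf, hψ s hs f hf, Formula.realize_imp]
  · intro X hX i hi
    lift i to Vt δ using mem_vonNeumann.1 hi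
    obtain ⟨φ, hφ⟩ := hG X hX
    obtain ⟨ψ, hψ⟩ := exists_formula_forall φ i
    obtain ⟨Z, hZ, hZ'⟩ := hex ψ
    refine ⟨Z, hZ, fun s hs ha => ?_⟩
    obtain ⟨f, hf⟩ := ha.exists_codes
    rw [hZ' s hs f hf, hψ]
    constructor
    · intro h t ht hta hag
      obtain ⟨g, hg⟩ := hta.exists_codes
      obtain ⟨a, rfl⟩ := (hf.agreeOff_iff hg i).1 hag
      exact (hφ t ht _ hg).2 (h a)
    · intro h a
      obtain ⟨t, ht, htc⟩ := exists_codes hγ hδ (Function.update f i a)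
      exact (hφ t ht _ htc).1 (h t ht htc.isAssign ((hf.agreeOff_iff htc i).2 ⟨a, rfl⟩))
  · rintro X hX s hs hsa hsD i hi ⟨t, ht, hta, hag, htX⟩
    lift i to Vt δ using mem_vonNeumann.1 hi
    obtain ⟨φ, hφ⟩ := hG X hX
    obtain ⟨ψ, hψ⟩ := exists_formula_forall (∼φ) i
    obtain ⟨f, hf⟩ := hsa.exists_codes
    obtain ⟨g, hg⟩ := hta.exists_codes
    obtain ⟨a, rfl⟩ := (hf.agreeOff_iff hg i).1 hag
    let f' : Vt δ → Vt δ := fun j =>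
      ⟨(f j).1, mem_vonNeumann.1 (hsD j.1 j.mem _ (f j).mem ((hf j _).2 rfl))⟩
    have hf' : e ∘ f' = f := funext fun j => Subtype.ext (he (f' j))
    have h₁ : ¬ ψ.Realize f := by
      rw [hψ]
      push Not
      exact ⟨a, by rw [Formula.realize_not, not_not, ← hφ t ht _ hg]; exact htX⟩
    rw [← hf', e.map_formula, hψ] at h₁
    push Not at h₁
    obtain ⟨b, hb⟩ := h₁
    rw [Formula.realize_not, not_not, ← e.map_formula] at hb
    have hup : e ∘ Function.update f' i b = Function.update f i (e b) := by
      rw [Function.comp_update, hf']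
    rw [hup] at hb
    obtain ⟨u, hu, huc⟩ := exists_codes hγ hδ (Function.update f i (e b))
    refine ⟨u, hu, huc.isAssign, (hf.agreeOff_iff huc i).2 ⟨_, rfl⟩, (hφ u hu _ huc).2 hb,
      fun c hc hcu => ?_⟩
    have := congrArg Subtype.val ((huc i ⟨c, mem_vonNeumann.1 hc⟩).1 hcu)
    rw [Function.update_self] at this
    dsimp only at this
    rw [this, he]
    exact b.mem

end Codes

section Codes

variable {δ γ : Ordinal.{0}}

theorem update_comp_eq_snoc {A M : Type*} [DecidableEq A] {ν : ℕ → A} (hν : Function.Injective ν)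
    {n : ℕ} (f : A → M) (a : M) : (fun k : Fin (n + 1) => Function.update f (ν n) a (ν k)) =
      Fin.snoc (α := fun _ => M) (fun k : Fin n => f (ν k)) a := by
  funext k
  refine Fin.lastCases ?_ (fun k => ?_) k
  · simp
  · rw [Fin.snoc_castSucc, Function.update_of_ne]
    · rfl
    · exact fun h => k.2.ne (hν h)

theorem LSet.exists_eq_var {n : ℕ} (t : LSet.Term (Empty ⊕ Fin n)) :
    ∃ k, t = Term.var (Sum.inr k) := by
  rcases t with ⟨k | k⟩ | ⟨f, _⟩
  · exact k.elim
  · exact ⟨k, rfl⟩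
  · exact f.elim

theorem IsElemWitness.exists_definable {G : ZFSet.{0}} (hγ : IsInaccOrd γ) (hδ : δ ≤ γ)
    (h : IsElemWitness (V_ δ) (V_ γ) G) {ν : ℕ → Vt δ} (hν : Function.Injective ν)
    {n : ℕ} (φ : LSet.BoundedFormula Empty n) :
    ∃ X ∈ G, ∀ t ⊆ V_ γ, ∀ f : Vt δ → Vt γ, Codes t f →
      (t ∈ X ↔ φ.Realize default (fun k : Fin n => f (ν k))) := by
  classical
  obtain ⟨h_false, h_eq, h_mem, h_imp, h_all, -⟩ := h
  induction φ with
  | falsum =>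
    obtain ⟨Z, hZ, hZ'⟩ := h_false
    exact ⟨Z, hZ, fun t ht f hf => iff_of_false (hZ' t ht hf.isAssign) id⟩
  | equal t₁ t₂ =>
    obtain ⟨k, rfl⟩ := LSet.exists_eq_var t₁
    obtain ⟨l, rfl⟩ := LSet.exists_eq_var t₂
    obtain ⟨Z, hZ, hZ'⟩ := h_eq (ν k).1 (ν k).mem (ν l).1 (ν l).mem
    refine ⟨Z, hZ, fun t ht f hf => (hZ' t ht hf.isAssign).trans ?_⟩
    change _ ↔ f (ν k) = f (ν l)
    constructor
    · rintro ⟨a, ha, h₁, h₂⟩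
      exact ((hf (ν k) ⟨a, mem_vonNeumann.1 ha⟩).1 h₁).symm.trans
        ((hf (ν l) ⟨a, mem_vonNeumann.1 ha⟩).1 h₂)
    · exact fun h => ⟨(f (ν k)).1, (f (ν k)).mem, (hf _ _).2 rfl, (hf _ _).2 h⟩
  | @rel n m r ts =>
    cases r
    obtain ⟨k, hk⟩ := LSet.exists_eq_var (ts 0)
    obtain ⟨l, hl⟩ := LSet.exists_eq_var (ts 1)
    obtain ⟨Z, hZ, hZ'⟩ := h_mem (ν k).1 (ν k).mem (ν l).1 (ν l).mem
    refine ⟨Z, hZ, fun t ht f hf => (hZ' t ht hf.isAssign).trans ?_⟩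
    change _ ↔ ((ts 0).realize _ : Vt γ).1 ∈ ((ts 1).realize _ : Vt γ).1
    rw [hk, hl]
    change _ ↔ (f (ν k)).1 ∈ (f (ν l)).1
    constructor
    · rintro ⟨a, ha, b, hb, h₁, h₂, h⟩
      have e₁ := congrArg Subtype.val ((hf (ν k) ⟨a, mem_vonNeumann.1 ha⟩).1 h₁)
      have e₂ := congrArg Subtype.val ((hf (ν l) ⟨b, mem_vonNeumann.1 hb⟩).1 h₂)
      dsimp only at e₁ e₂
      rwa [← e₁, ← e₂]
    · exact fun h => ⟨_, (f (ν k)).mem, _, (f (ν l)).mem, (hf _ _).2 rfl, (hf _ _).2 rfl, h⟩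
  | imp φ ψ ihφ ihψ =>
    obtain ⟨X, hX, hX'⟩ := ihφ
    obtain ⟨Y, hY, hY'⟩ := ihψ
    obtain ⟨Z, hZ, hZ'⟩ := h_imp X hX Y hY
    refine ⟨Z, hZ, fun t ht f hf => (hZ' t ht hf.isAssign).trans ?_⟩
    rw [hX' t ht f hf, hY' t ht f hf]
    rfl
  | @all n φ ih =>
    obtain ⟨X, hX, hX'⟩ := ih
    obtain ⟨Z, hZ, hZ'⟩ := h_all X hX (ν n).1 (ν n).mem
    refine ⟨Z, hZ, fun s hs f hf => (hZ' s hs hf.isAssign).trans ?_⟩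
    rw [BoundedFormula.realize_all]
    constructor
    · intro h a
      obtain ⟨t, ht, htc⟩ := exists_codes hγ hδ (Function.update f (ν n) a)
      have := (hX' t ht _ htc).1
        (h t ht htc.isAssign ((hf.agreeOff_iff htc (ν n)).2 ⟨a, rfl⟩))
      rwa [update_comp_eq_snoc hν] at this
    · intro h t ht hta hag
      obtain ⟨g, hg⟩ := hta.exists_codes
      obtain ⟨a, rfl⟩ := (hf.agreeOff_iff hg (ν n)).1 hag
      rw [hX' t ht _ hg, update_comp_eq_snoc hν]
      exact h a

theorem IsElemWitness.velem {G : ZFSet.{0}} (hδ : IsInaccOrd δ) (hγ : IsInaccOrd γ) (hle : δ ≤ γ)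
    (h : IsElemWitness (V_ δ) (V_ γ) G) : VElem δ γ := by
  classical
  let ν : ℕ → Vt δ := fun n => ⟨(n : Ordinal).toZFSet, by
    rw [rank_toZFSet]
    exact (natCast_lt_omega0 n).trans hδ.omega0_lt⟩
  have hν : Function.Injective ν := fun m n hmn => by
    have := congrArg (fun x : Vt δ => x.1.rank) hmn
    simpa [ν, rank_toZFSet] using this
  let ι : Vt δ ↪[LSet] Vt γ :=
    { toFun := fun x => ⟨x.1, x.2.trans_le hle⟩
      inj' := fun x y hxy => by simpa [Subtype.ext_iff] using hxy
      map_fun' := fun f => f.elim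
      map_rel' := fun r x => by cases r; exact Iff.rfl }
  refine ⟨ι.toElementaryEmbedding fun n φ x a hφ => ?_, fun x => rfl⟩
  obtain ⟨X, hX, hX'⟩ := h.exists_definable hγ hle hν φ
  let f₀ : Vt δ → Vt δ := fun i => if hi : ∃ k : Fin n, ν k = i then x hi.choose else ν 0
  have hf₀ : ∀ k : Fin n, f₀ (ν k) = x k := fun k => by
    have hi : ∃ k' : Fin n, ν k' = ν k := ⟨k, rfl⟩
    simp only [f₀, dif_pos hi]
    rw [Fin.ext (hν hi.choose_spec)]
  have hx : (fun k : Fin n => (ι ∘ f₀) (ν k)) = ι ∘ x := funext fun k => by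
    simp only [Function.comp_apply, hf₀]
  obtain ⟨s, hs, hsc⟩ := exists_codes hγ hle (ι ∘ f₀)
  obtain ⟨t, ht, htc⟩ := exists_codes hγ hle (Function.update (ι ∘ f₀) (ν n) a)
  have htX : t ∈ X := by
    rw [hX' t ht _ htc, update_comp_eq_snoc hν, hx]
    exact hφ
  obtain ⟨u, hu, hua, hag, huX, huD⟩ := h.2.2.2.2.2 X hX s hs hsc.isAssign
    (fun i hi b hb hib => by
      have := congrArg Subtype.val
        ((hsc ⟨i, mem_vonNeumann.1 hi⟩ ⟨b, mem_vonNeumann.1 hb⟩).1 hib)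
      dsimp only at this
      rw [this]
      exact (f₀ _).mem)
    (ν n).1 (ν n).mem ⟨t, ht, htc.isAssign, (hsc.agreeOff_iff htc _).2 ⟨a, rfl⟩, htX⟩
  obtain ⟨g, hg⟩ := hua.exists_codes
  obtain ⟨b, rfl⟩ := (hsc.agreeOff_iff hg (ν n)).1 hag
  have hb : b.1 ∈ V_ δ := huD b.1 b.mem ((hg _ _).2 (by simp))
  refine ⟨⟨b.1, mem_vonNeumann.1 hb⟩, ?_⟩
  rw [hX' u hu _ hg, update_comp_eq_snoc hν, hx] at huX
  exact huX

end Codes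

/-! ### The diagonal enumeration -/

/-- `β` is the least ordinal omitted at the least level `η` at which `K` omits an ordinal
`≤ η`. -/
def IsDiagAt (K : Ordinal.{0} → Ordinal.{0} → Prop) (β η : Ordinal.{0}) : Prop :=
  β ≤ η ∧ ¬ K β η ∧ (∀ η' < η, ∀ β' ≤ η', K β' η') ∧ ∀ β' < β, K β' η

section IsDiagAt

variable {K : Ordinal.{0} → Ordinal.{0} → Prop} {β β' η η' : Ordinal.{0}}

theorem IsDiagAt.level_le (h : IsDiagAt K β η) (hle : β' ≤ η') (hK : ¬ K β' η') : η ≤ η' := by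
  by_contra! hlt
  exact hK (h.2.2.1 η' hlt β' hle)

theorem IsDiagAt.unique (h : IsDiagAt K β η) (h' : IsDiagAt K β' η') : β = β' := by
  obtain rfl : η = η' := le_antisymm (h.level_le h'.1 h'.2.1) (h'.level_le h.1 h.2.1)
  refine le_antisymm ?_ ?_ <;> by_contra! hlt
  · exact h'.2.1 (h.2.2.2 β' hlt)
  · exact h.2.1 (h'.2.2.2 β hlt)

theorem exists_isDiagAt (hle : β ≤ η) (hK : ¬ K β η) : ∃ β η, IsDiagAt K β η := by
  let s := {η | ∃ β ≤ η, ¬ K β η}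
  have hs : s.Nonempty := ⟨η, β, hle, hK⟩
  let t := {β | ¬ K β (sInf s)}
  obtain ⟨b, hb, hbK⟩ := csInf_mem hs
  have ht : t.Nonempty := ⟨b, hbK⟩
  refine ⟨sInf t, sInf s, (csInf_le' hbK).trans hb, csInf_mem ht, fun η' hη' β' hβ' => ?_,
    fun β' hβ' => ?_⟩
  · by_contra hc
    exact notMem_of_lt_csInf' hη' ⟨β', hβ', hc⟩
  · by_contra hc
    exact notMem_of_lt_csInf' hβ' hc

end IsDiagAt

/-- `V_δ ≺ V_γ` is a proper elementary extension with `δ` and `γ` inaccessible. -/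
def ElemStep (δ γ : Ordinal.{0}) : Prop :=
  IsInaccOrd δ ∧ IsInaccOrd γ ∧ δ < γ ∧ VElem δ γ

/-- An elementary step that is not a limit of elementary steps from `δ`. -/
def TameStep (δ γ : Ordinal.{0}) : Prop :=
  ElemStep δ γ ∧ ∃ μ < γ, ∀ γ' < γ, ElemStep δ γ' → γ' < μ

/-- The ordinal assigned to the stage `α`: it diagonalizes against the values at the tame steps
`γ < α` from `δ`. -/
noncomputable def diagVal (δ α : Ordinal.{0}) : Ordinal.{0} :=
  sInf {β | ∃ η, IsDiagAt
    (fun β η => ∃ γ : Set.Iio α, TameStep δ γ.1 ∧ η < γ.1 ∧ diagVal δ γ.1 = β) β η}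
termination_by α
decreasing_by exact γ.2

/-- The value `β` is assigned to some tame step between `η` and `α`. -/
def Hit (δ α β η : Ordinal.{0}) : Prop :=
  ∃ γ < α, TameStep δ γ ∧ η < γ ∧ diagVal δ γ = β

section diagVal

variable {δ α β η μ : Ordinal.{0}}

theorem isDiagAt_diagVal (δ α : Ordinal.{0}) : ∃ η, IsDiagAt (Hit δ α) (diagVal δ α) η := by
  have hK : (fun β η => ∃ γ : Set.Iio α, TameStep δ γ.1 ∧ η < γ.1 ∧ diagVal δ γ.1 = β)
      = Hit δ α := by
    funext β η
    exact propext ⟨fun ⟨γ, h⟩ => ⟨γ.1, γ.2, h⟩, fun ⟨γ, hγ, h⟩ => ⟨⟨γ, hγ⟩, h⟩⟩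
  rw [diagVal, hK]
  refine csInf_mem (s := {β | ∃ η, IsDiagAt (Hit δ α) β η}) ?_
  refine exists_isDiagAt (β := 0) (η := α) zero_le ?_
  rintro ⟨γ, hγ, -, hγ', -⟩
  exact hγ.not_gt hγ'

theorem exists_isDiagAt_iff : (∃ η, IsDiagAt (Hit δ α) β η) ↔ β = diagVal δ α := by
  obtain ⟨η, hη⟩ := isDiagAt_diagVal δ α
  constructor
  · rintro ⟨η', h⟩
    exact h.unique hη
  · rintro rfl
    exact ⟨η, hη⟩

theorem diagVal_congr {ρ : Ordinal.{0}} (h : ∀ γ, TameStep δ γ → (γ < α ↔ γ < ρ)) :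
    diagVal δ α = diagVal δ ρ := by
  have hK : Hit δ α = Hit δ ρ := by
    funext β η
    refine propext (exists_congr fun γ => ?_)
    have := h γ
    tauto
  obtain ⟨η, hη⟩ := isDiagAt_diagVal δ α
  rw [hK] at hη
  exact exists_isDiagAt_iff.1 ⟨η, hη⟩

theorem diagVal_le (h : ∀ γ < α, TameStep δ γ → γ < μ) : diagVal δ α ≤ μ := by
  obtain ⟨η, hη⟩ := isDiagAt_diagVal δ α
  refine hη.1.trans (hη.level_le (β' := 0) (zero_le (a := μ)) ?_)
  rintro ⟨γ, hγ, hγ', hγμ, -⟩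
  exact (h γ hγ hγ').not_gt hγμ

/-- If the tame steps from `δ` are unbounded, then every value is assigned unboundedly often. -/
theorem exists_tameStep_diagVal_eq (hδ : ∀ θ, ∃ γ > θ, TameStep δ γ) (β θ : Ordinal.{0}) :
    ∃ γ > θ, TameStep δ γ ∧ diagVal δ γ = β := by
  by_contra! hne
  let ξ := max β θ
  have hmiss : ∀ α, ¬ Hit δ α β ξ := by
    rintro α ⟨γ, -, hγ, hξ, h⟩
    exact hne γ ((le_max_right _ _).trans_lt hξ) hγ h
  choose lev hlev using isDiagAt_diagVal δ
  have hlevle : ∀ α, lev α ≤ ξ := fun α => (hlev α).level_le (le_max_left _ _) (hmiss α)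
  let s := {γ | ξ < γ ∧ TameStep δ γ}
  let F : s → Set.Iic ξ × Set.Iic ξ := fun γ =>
    (⟨diagVal δ γ.1, (hlev γ.1).1.trans (hlevle γ.1)⟩, ⟨lev γ.1, hlevle γ.1⟩)
  have hne' : ∀ γ γ' : s, γ.1 < γ'.1 → F γ ≠ F γ' := by
    intro γ γ' hlt he
    have h₁ : diagVal δ γ.1 = diagVal δ γ'.1 := congrArg (fun p => p.1.1) he
    refine (hlev γ'.1).2.1 ⟨γ.1, hlt, γ.2.2, (hlevle _).trans_lt γ.2.1, h₁⟩
  have hF : Function.Injective F := by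
    intro γ γ' he
    rcases lt_trichotomy γ.1 γ'.1 with hlt | heq | hlt
    · exact (hne' _ _ hlt he).elim
    · exact Subtype.ext heq
    · exact (hne' _ _ hlt he.symm).elim
  have : Small.{0} s := small_of_injective hF
  obtain ⟨b, hb⟩ := Ordinal.bddAbove_of_small (s := s)
  obtain ⟨γ, hγ, hγ'⟩ := hδ (max b ξ)
  exact (hb ⟨(le_max_right _ _).trans_lt hγ, hγ'⟩).not_gt ((le_max_left _ _).trans_lt hγ)

end diagVal

theorem IsUplifting.exists_tameStep {κ : Ordinal.{0}} (hκ : IsUplifting κ) (θ : Ordinal.{0}) :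
    ∃ γ > θ, TameStep κ γ := by
  let s := {γ | θ < γ ∧ ElemStep κ γ}
  have hs : s.Nonempty := by
    obtain ⟨γ, hγ, hθ, hlt, he⟩ := hκ.2 (θ + 1)
    exact ⟨γ, (lt_add_one θ).trans_le hθ, hκ.1, hγ, hlt, he⟩
  obtain ⟨hθ, he⟩ := csInf_mem hs
  refine ⟨sInf s, hθ, he, θ + 1, he.2.1.add_one_lt hθ, fun γ' hlt h' => ?_⟩
  rw [Order.lt_add_one_iff]
  by_contra! hc
  exact notMem_of_lt_csInf' hlt ⟨hc, h'⟩

/-! ### Uniform definability of the diagonal enumeration -/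

/-- The set-level version of `ElemStep`. -/
def SetStep (D C : ZFSet.{0}) : Prop :=
  ∃ δ γ, ElemStep δ γ ∧ D = V_ δ ∧ C = V_ γ

/-- The set-level version of `TameStep`. -/
def SetTame (D C : ZFSet.{0}) : Prop :=
  ∃ δ γ, TameStep δ γ ∧ D = V_ δ ∧ C = V_ γ

theorem setStep_vonNeumann {δ γ : Ordinal.{0}} : SetStep (V_ δ) (V_ γ) ↔ ElemStep δ γ := by
  constructor
  · rintro ⟨δ', γ', h, h₁, h₂⟩
    rwa [vonNeumann_inj.1 h₁, vonNeumann_inj.1 h₂]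
  · exact fun h => ⟨δ, γ, h, rfl, rfl⟩

theorem setTame_vonNeumann {δ γ : Ordinal.{0}} : SetTame (V_ δ) (V_ γ) ↔ TameStep δ γ := by
  constructor
  · rintro ⟨δ', γ', h, h₁, h₂⟩
    rwa [vonNeumann_inj.1 h₁, vonNeumann_inj.1 h₂]
  · exact fun h => ⟨δ, γ, h, rfl, rfl⟩

theorem SetTame.exists_eq {δ : Ordinal.{0}} {C : ZFSet.{0}} (h : SetTame (V_ δ) C) :
    ∃ γ, TameStep δ γ ∧ C = V_ γ := by
  obtain ⟨δ', γ, h, h₁, rfl⟩ := h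
  rw [← vonNeumann_inj.1 h₁] at h
  exact ⟨γ, h, rfl⟩

theorem setTame_iff {D C : ZFSet.{0}} : SetTame D C ↔
    SetStep D C ∧ ∃ m ∈ C, ∀ C' ∈ C, SetStep D C' → C' ∈ m := by
  constructor
  · rintro ⟨δ, γ, ⟨h, μ, hμ, hb⟩, rfl, rfl⟩
    refine ⟨⟨δ, γ, h, rfl, rfl⟩, V_ μ, vonNeumann_mem_vonNeumann_iff.2 hμ, fun C' hC' hs => ?_⟩
    obtain ⟨δ', γ', h', h₁, rfl⟩ := hs
    rw [← vonNeumann_inj.1 h₁] at h'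
    exact vonNeumann_mem_vonNeumann_iff.2 (hb γ' (vonNeumann_mem_vonNeumann_iff.1 hC') h')
  · rintro ⟨⟨δ, γ, h, rfl, rfl⟩, m, hm, hb⟩
    refine ⟨δ, γ, ⟨h, m.rank, mem_vonNeumann.1 hm, fun γ' hγ' hs => ?_⟩, rfl, rfl⟩
    simpa using rank_lt_of_mem
      (hb (V_ γ') (vonNeumann_mem_vonNeumann_iff.2 hγ') (setStep_vonNeumann.2 hs))

theorem UDef.setStep (i j : ℕ) : UDef fun _ v => SetStep (v i).1 (v j).1 := by
  refine UDef.congr (P := fun α v => IsUniv (v i).1 ∧ IsUniv (v j).1 ∧ (v i).1 ∈ (v j).1 ∧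
    ∃ G : Vt α, IsElemWitness (v i).1 (v j).1 G.1) ?_ fun α hα v => ?_
  · exact (isUniv i).and ((isUniv j).and ((mem i j).and
      (ex (isElemWitness (i + 1) (j + 1) 0))))
  · constructor
    · rintro ⟨h₁, h₂, hm, G, hG⟩
      obtain ⟨δ, hδ, h₁⟩ := h₁.exists_eq
      obtain ⟨γ, hγ, h₂⟩ := h₂.exists_eq
      rw [h₁, h₂] at hG hm
      have hlt := vonNeumann_mem_vonNeumann_iff.1 hm
      exact ⟨δ, γ, ⟨hδ, hγ, hlt, hG.velem hδ hγ hlt.le⟩, h₁, h₂⟩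
    · rintro ⟨δ, γ, ⟨hδ, hγ, hlt, he⟩, h₁, h₂⟩
      have hγα : γ < α := by simpa [h₂] using (v j).2
      rw [h₁, h₂]
      obtain ⟨G, hG, hG'⟩ := exists_isElemWitness hγ hlt.le he
      refine ⟨isUniv_vonNeumann hδ, isUniv_vonNeumann hγ, vonNeumann_mem_vonNeumann_iff.2 hlt,
        ⟨G, (rank_mono hG).trans_lt ?_⟩, hG'⟩
      rw [rank_powerset, rank_powerset, rank_vonNeumann]
      exact hα.add_one_lt (hα.add_one_lt hγα)

theorem UDef.setTame (i j : ℕ) : UDef fun _ v => SetTame (v i).1 (v j).1 := by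
  simp only [setTame_iff]
  repeat' first
    | exact UDef.mem _ _
    | exact UDef.setStep _ _
    | apply UDef.ball
    | apply UDef.bex
    | apply UDef.and
    | apply UDef.imp

/-- The set-level version of `Hit`, with the values given by the graph `h`. -/
def SetHit (D h c b e : ZFSet.{0}) : Prop :=
  ∃ C ∈ c, SetTame D C ∧ e ∈ C ∧ pair C b ∈ h

/-- The set-level version of `IsDiagAt`. -/
def SetDiagAt (D h c b e : ZFSet.{0}) : Prop :=
  e.IsOrdinal ∧ b ⊆ e ∧ ¬ SetHit D h c b e ∧
    (∀ e' ∈ e, ∀ b' ⊆ e', b'.IsOrdinal → SetHit D h c b' e') ∧ ∀ b' ∈ b, SetHit D h c b' e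

theorem UDef.setHit (i j k l m : ℕ) :
    UDef fun _ v => SetHit (v i).1 (v j).1 (v k).1 (v l).1 (v m).1 := by
  unfold SetHit
  repeat' first
    | exact UDef.mem _ _
    | exact UDef.setTame _ _
    | exact UDef.pair_mem _ _ _
    | apply UDef.bex
    | apply UDef.and

theorem UDef.setDiagAt (i j k l m : ℕ) :
    UDef fun _ v => SetDiagAt (v i).1 (v j).1 (v k).1 (v l).1 (v m).1 := by
  unfold SetDiagAt
  repeat' first
    | exact UDef.isOrdinal _
    | exact UDef.subset _ _
    | exact UDef.setHit _ _ _ _ _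
    | exact (UDef.setHit _ _ _ _ _).not
    | apply UDef.ball_subset
    | apply UDef.ball
    | apply UDef.and
    | apply UDef.imp

/-- The definition inside `V_α` of the value at stage `α`. -/
def DiagIn (α : Ordinal.{0}) (D b : ZFSet.{0}) : Prop :=
  ∃ m h : Vt α, (∀ C : Vt α, SetTame D C.1 → C.1 ∈ m.1) ∧
    (∀ C : Vt α, SetTame D C.1 → ∀ b : Vt α, b.1.IsOrdinal →
      (pair C.1 b.1 ∈ h.1 ↔ ∃ e : Vt α, SetDiagAt D h.1 C.1 b.1 e.1)) ∧
    ∃ e : Vt α, SetDiagAt D h.1 m.1 b e.1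

theorem UDef.bounded (i j : ℕ) :
    UDef fun α v => ∀ C : Vt α, SetTame (v i).1 C.1 → C.1 ∈ (v j).1 :=
  all ((setTame (i + 1) 0).imp (mem 0 (j + 1)))

theorem UDef.diagIn (i j : ℕ) : UDef fun α v => DiagIn α (v i).1 (v j).1 := by
  unfold DiagIn
  repeat' first
    | exact UDef.mem _ _
    | exact UDef.pair_mem _ _ _
    | exact UDef.isOrdinal _
    | exact UDef.setTame _ _
    | exact UDef.setDiagAt _ _ _ _ _
    | apply UDef.all
    | apply UDef.ex
    | apply UDef.and
    | apply UDef.iff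
    | apply UDef.imp

section Semantics

variable {δ α ρ β η μ : Ordinal.{0}} {h c : ZFSet.{0}}

theorem setHit_iff (hc : ∀ γ, TameStep δ γ → (V_ γ ∈ c ↔ γ < ρ))
    (hh : ∀ γ < ρ, TameStep δ γ → ∀ o < α, (pair (V_ γ) o.toZFSet ∈ h ↔ o = diagVal δ γ))
    (hβ : β < α) : SetHit (V_ δ) h c β.toZFSet η.toZFSet ↔ Hit δ ρ β η := by
  constructor
  · rintro ⟨C, hC, hT, hη, hp⟩
    obtain ⟨γ, hγ, rfl⟩ := hT.exists_eq
    have hlt := (hc γ hγ).1 hC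
    exact ⟨γ, hlt, hγ, by simpa [mem_vonNeumann] using hη, ((hh γ hlt hγ β hβ).1 hp).symm⟩
  · rintro ⟨γ, hlt, hγ, hη, hd⟩
    exact ⟨V_ γ, (hc γ hγ).2 hlt, setTame_vonNeumann.2 hγ, by simpa [mem_vonNeumann] using hη,
      (hh γ hlt hγ β hβ).2 hd.symm⟩

theorem setDiagAt_iff (hc : ∀ γ, TameStep δ γ → (V_ γ ∈ c ↔ γ < ρ))
    (hh : ∀ γ < ρ, TameStep δ γ → ∀ o < α, (pair (V_ γ) o.toZFSet ∈ h ↔ o = diagVal δ γ))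
    (hβ : β < α) (hη : η < α) :
    SetDiagAt (V_ δ) h c β.toZFSet η.toZFSet ↔ IsDiagAt (Hit δ ρ) β η := by
  unfold SetDiagAt IsDiagAt
  rw [setHit_iff hc hh hβ, toZFSet_subset_toZFSet_iff]
  have h₁ : (∀ e' ∈ η.toZFSet, ∀ b' ⊆ e', b'.IsOrdinal → SetHit (V_ δ) h c b' e') ↔
      ∀ η' < η, ∀ β' ≤ η', Hit δ ρ β' η' := by
    constructor
    · intro H η' hη' β' hβ'
      exact (setHit_iff hc hh ((hβ'.trans_lt hη').trans hη)).1 (H _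
        (toZFSet_mem_toZFSet_iff.2 hη') _ (toZFSet_subset_toZFSet_iff.2 hβ') (isOrdinal_toZFSet _))
    · intro H e' he' b' hb' hb
      obtain ⟨η', hη', rfl⟩ := mem_toZFSet_iff.1 he'
      obtain ⟨β', rfl⟩ := isOrdinal_iff_mem_range_toZFSet.1 hb
      have hβ' := toZFSet_subset_toZFSet_iff.1 hb'
      exact (setHit_iff hc hh ((hβ'.trans_lt hη').trans hη)).2 (H η' hη' β' hβ')
  have h₂ : (∀ b' ∈ β.toZFSet, SetHit (V_ δ) h c b' η.toZFSet) ↔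
      ∀ β' < β, Hit δ ρ β' η := by
    constructor
    · intro H β' hβ'
      exact (setHit_iff hc hh (hβ'.trans hβ)).1 (H _ (toZFSet_mem_toZFSet_iff.2 hβ'))
    · intro H b' hb'
      obtain ⟨β', hβ', rfl⟩ := mem_toZFSet_iff.1 hb'
      exact (setHit_iff hc hh (hβ'.trans hβ)).2 (H β' hβ')
  rw [h₁, h₂]
  exact and_iff_right (isOrdinal_toZFSet η)

theorem exists_setDiagAt_iff (hc : ∀ γ, TameStep δ γ → (V_ γ ∈ c ↔ γ < ρ))
    (hh : ∀ γ < ρ, TameStep δ γ → ∀ o < α, (pair (V_ γ) o.toZFSet ∈ h ↔ o = diagVal δ γ))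
    (hβ : β < α) (hμ : μ < α) (hb : ∀ γ < ρ, TameStep δ γ → γ < μ) :
    (∃ e : Vt α, SetDiagAt (V_ δ) h c β.toZFSet e.1) ↔ β = diagVal δ ρ := by
  constructor
  · rintro ⟨⟨e, he⟩, hd⟩
    obtain ⟨η, rfl⟩ := isOrdinal_iff_mem_range_toZFSet.1 hd.1
    rw [rank_toZFSet] at he
    exact exists_isDiagAt_iff.1 ⟨η, (setDiagAt_iff hc hh hβ he).1 hd⟩
  · rintro rfl
    obtain ⟨η, hη⟩ := isDiagAt_diagVal δ ρ
    have hlt : η < α := by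
      refine (hη.level_le (β' := 0) (η' := μ) zero_le ?_).trans_lt hμ
      rintro ⟨γ, hγ, hγ', hγμ, -⟩
      exact (hb γ hγ hγ').not_gt hγμ
    exact ⟨⟨η.toZFSet, by simpa using hlt⟩, (setDiagAt_iff hc hh hβ hlt).2 hη⟩

theorem diagIn_iff (hα : IsInaccOrd α) (hβ : β < α) :
    DiagIn α (V_ δ) β.toZFSet ↔
      (∃ μ < α, ∀ γ < α, TameStep δ γ → γ < μ) ∧ β = diagVal δ α := by
  have hV : ∀ ρ γ, TameStep δ γ → (V_ γ ∈ V_ ρ ↔ γ < ρ) := fun ρ γ _ =>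
    vonNeumann_mem_vonNeumann_iff
  constructor
  · rintro ⟨m, h, hm, hrec, hd⟩
    have hm' : ∀ γ < α, TameStep δ γ → V_ γ ∈ m.1 := fun γ hγ hT =>
      hm ⟨V_ γ, by simpa using hγ⟩ (setTame_vonNeumann.2 hT)
    have hb : ∀ γ < α, TameStep δ γ → γ < m.1.rank := fun γ hγ hT => by
      simpa using rank_lt_of_mem (hm' γ hγ hT)
    have hh : ∀ γ < α, TameStep δ γ → ∀ o < α,
        (pair (V_ γ) o.toZFSet ∈ h.1 ↔ o = diagVal δ γ) := by
      intro γ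
      induction γ using WellFoundedLT.induction with
      | ind γ ih =>
        intro hγ hT o ho
        refine (hrec ⟨V_ γ, by simpa using hγ⟩ (setTame_vonNeumann.2 hT)
          ⟨o.toZFSet, by simpa using ho⟩ (isOrdinal_toZFSet o)).trans ?_
        exact exists_setDiagAt_iff (hV γ) (fun γ' h' => ih γ' h' (h'.trans hγ)) ho hγ
          fun _ h' _ => h'
    refine ⟨⟨m.1.rank, m.2, hb⟩, (exists_setDiagAt_iff (fun γ hT => ⟨fun hγ => ?_,
      fun hγ => hm' γ hγ hT⟩) hh hβ m.2 hb).1 hd⟩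
    simpa using (rank_lt_of_mem hγ).trans m.2
  · rintro ⟨⟨μ, hμ, hb⟩, rfl⟩
    let h : ZFSet := range fun γ : Set.Iio μ => pair (V_ γ.1) (diagVal δ γ.1).toZFSet
    have hr : h.rank < α := by
      refine hα.rank_lt_of_pairs hμ fun p hp => ?_
      obtain ⟨γ, rfl⟩ := mem_range.1 hp
      refine ⟨_, _, ?_, ?_, rfl⟩
      · simpa using γ.2.le
      · simpa using (diagVal_le fun _ h' _ => h').trans γ.2.le
    have hh : ∀ γ < α, TameStep δ γ → ∀ o < α,
        (pair (V_ γ) o.toZFSet ∈ h ↔ o = diagVal δ γ) := by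
      intro γ hγ hT o _
      constructor
      · intro hp
        obtain ⟨γ', hp⟩ := mem_range.1 hp
        obtain ⟨h₁, h₂⟩ := pair_injective hp
        rw [vonNeumann_inj] at h₁
        rw [← toZFSet_injective h₂, h₁]
      · rintro rfl
        exact mem_range.2 ⟨⟨γ, hb γ hγ hT⟩, rfl⟩
    refine ⟨⟨V_ μ, by simpa using hμ⟩, ⟨h, hr⟩, fun C hC => ?_, fun C hC b hb' => ?_, ?_⟩
    · obtain ⟨γ, hT, hC'⟩ := hC.exists_eq
      have hγ : γ < α := by simpa [hC'] using C.2
      simpa [hC'] using hb γ hγ hT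
    · obtain ⟨γ, hT, hC'⟩ := hC.exists_eq
      have hγ : γ < α := by simpa [hC'] using C.2
      obtain ⟨o, ho⟩ := isOrdinal_iff_mem_range_toZFSet.1 hb'
      have hoα : o < α := by simpa [← ho] using b.2
      rw [hC', ← ho, hh γ hγ hT o hoα, exists_setDiagAt_iff (hV γ)
        (fun γ' h' => hh γ' (h'.trans hγ)) hoα hγ fun _ h' _ => h']
    · refine (exists_setDiagAt_iff (ρ := α) (fun γ hT => ?_) hh hβ hμ hb).2 rfl
      rw [vonNeumann_mem_vonNeumann_iff]
      exact ⟨fun h' => h'.trans hμ, fun h' => hb γ h' hT⟩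

end Semantics

/-! ### The Laver function -/

open Classical in
/-- The approximation at `α` to the Laver function: it assigns `diagVal δ α` to `δ` as long as the
tame steps from `δ` are bounded in `α`. -/
noncomputable def laverAt (α δ : Ordinal.{0}) : Ordinal.{0} :=
  if IsInaccOrd δ ∧ ∃ μ < α, ∀ γ < α, TameStep δ γ → γ < μ then diagVal δ α else 0

open Classical in
/-- The Laver function: it assigns to `δ` the value of `diagVal δ` past all tame steps from `δ`. -/
noncomputable def laver (δ : Ordinal.{0}) : Ordinal.{0} :=
  if h : IsInaccOrd δ ∧ ∃ μ, ∀ γ, TameStep δ γ → γ < μ then diagVal δ h.2.choose else 0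

theorem laverAt_lt {α : Ordinal.{0}} (hα : IsInaccOrd α) (δ : Ordinal.{0}) : laverAt α δ < α := by
  rw [laverAt]
  split_ifs with h
  · obtain ⟨-, μ, hμ, hb⟩ := h
    exact (diagVal_le hb).trans_lt hμ
  · exact hα.pos

section fInterp

variable {α : Ordinal.{0}} {f : Ordinal.{0} → Ordinal.{0}} {x : Vt α}

theorem fInterp_of_isOrdinal (hx : x.1.IsOrdinal) (hf : f x.1.rank < α) :
    (fInterp α f x).1 = (f x.1.rank).toZFSet := by
  have h : x.1.IsOrdinal ∧ ∃ y : ZFSet, y.IsOrdinal ∧ y.rank = f x.1.rank ∧ y.rank < α :=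
    ⟨hx, (f x.1.rank).toZFSet, isOrdinal_toZFSet _, rank_toZFSet _, by rwa [rank_toZFSet]⟩
  rw [fInterp, dif_pos h]
  exact (h.2.choose_spec.1.toZFSet_rank_eq).symm.trans (congrArg toZFSet h.2.choose_spec.2.1)

theorem fInterp_of_not_isOrdinal (hx : ¬ x.1.IsOrdinal) : fInterp α f x = x :=
  dif_neg fun h => hx h.1

theorem fInterp_congr {f' : Ordinal.{0} → Ordinal.{0}} (hf : ∀ δ < α, f δ < α)
    (h : ∀ δ < α, f δ = f' δ) : fInterp α f = fInterp α f' := by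
  funext x
  by_cases hx : x.1.IsOrdinal
  · have hlt := hf _ x.2
    rw [Subtype.ext_iff, fInterp_of_isOrdinal hx hlt, fInterp_of_isOrdinal hx (h _ x.2 ▸ hlt),
      h _ x.2]
  · rw [fInterp_of_not_isOrdinal hx, fInterp_of_not_isOrdinal hx]

theorem fvElem_congr_left {f' g : Ordinal.{0} → Ordinal.{0}} {γ : Ordinal.{0}}
    (hf : ∀ δ < α, f δ < α) (h : ∀ δ < α, f δ = f' δ) (he : FVElem α γ f g) : FVElem α γ f' g := by
  have hS : LFStructure α f = LFStructure α f' := by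
    simp only [LFStructure, fInterp_congr hf h]
  rwa [FVElem, hS] at he

end fInterp

/-- Among the universes `D`, the ordinal `x` is a subset but not an element only of `V_x`. -/
theorem isUniv_and_subset_iff {δ : Ordinal.{0}} {D : ZFSet.{0}} :
    (IsUniv D ∧ δ.toZFSet ⊆ D ∧ δ.toZFSet ∉ D) ↔ IsInaccOrd δ ∧ D = V_ δ := by
  constructor
  · rintro ⟨h, hs, hn⟩
    obtain ⟨γ, hγ, rfl⟩ := h.exists_eq
    rw [subset_vonNeumann, rank_toZFSet] at hs
    rw [mem_vonNeumann, rank_toZFSet, not_lt] at hn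
    rw [hs.antisymm hn]
    exact ⟨hγ, rfl⟩
  · rintro ⟨h, rfl⟩
    exact ⟨isUniv_vonNeumann h, toZFSet_subset_vonNeumann δ, by simp [mem_vonNeumann]⟩

theorem eq_laverAt_iff {α δ β : Ordinal.{0}} (hα : IsInaccOrd α) (hδ : δ < α) (hβ : β < α) :
    β = laverAt α δ ↔
      (∃ D : Vt α, (IsUniv D.1 ∧ δ.toZFSet ⊆ D.1 ∧ δ.toZFSet ∉ D.1) ∧
        DiagIn α D.1 β.toZFSet) ∨
      (¬ ∃ D : Vt α, (IsUniv D.1 ∧ δ.toZFSet ⊆ D.1 ∧ δ.toZFSet ∉ D.1) ∧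
        ∃ b : Vt α, b.1.IsOrdinal ∧ DiagIn α D.1 b.1) ∧ β.toZFSet = ∅ := by
  have hD : ∀ p : ZFSet → Prop, (∃ D : Vt α, (IsUniv D.1 ∧ δ.toZFSet ⊆ D.1 ∧ δ.toZFSet ∉ D.1) ∧
      p D.1) ↔ IsInaccOrd δ ∧ p (V_ δ) := by
    intro p
    constructor
    · rintro ⟨D, h, hp⟩
      obtain ⟨h, h'⟩ := isUniv_and_subset_iff.1 h
      exact ⟨h, h' ▸ hp⟩
    · rintro ⟨h, hp⟩
      exact ⟨⟨V_ δ, by simpa using hδ⟩, isUniv_and_subset_iff.2 ⟨h, rfl⟩, hp⟩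
  have hb : (∃ b : Vt α, b.1.IsOrdinal ∧ DiagIn α (V_ δ) b.1) ↔
      ∃ μ < α, ∀ γ < α, TameStep δ γ → γ < μ := by
    constructor
    · rintro ⟨⟨b, hb⟩, ho, hd⟩
      obtain ⟨o, rfl⟩ := isOrdinal_iff_mem_range_toZFSet.1 ho
      rw [rank_toZFSet] at hb
      exact ((diagIn_iff hα hb).1 hd).1
    · rintro ⟨μ, hμ, hb⟩
      have hlt := (diagVal_le hb).trans_lt hμ
      exact ⟨⟨(diagVal δ α).toZFSet, by simpa using hlt⟩, isOrdinal_toZFSet _,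
        (diagIn_iff hα hlt).2 ⟨⟨μ, hμ, hb⟩, rfl⟩⟩
  rw [hD (fun D => DiagIn α D β.toZFSet), hD (fun D => ∃ b : Vt α, b.1.IsOrdinal ∧ DiagIn α D b.1),
    hb, diagIn_iff hα hβ, ← toZFSet_zero, toZFSet_injective.eq_iff, laverAt]
  generalize (∃ μ < α, ∀ γ < α, TameStep δ γ → γ < μ) = B
  split_ifs <;> tauto

theorem uDefFun_laverAt : UDefFun laverAt := by
  intro i j
  refine UDef.congr (P := fun α v => (¬ (v j).1.IsOrdinal ∧ v i = v j) ∨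
    ((v j).1.IsOrdinal ∧ (v i).1.IsOrdinal ∧
      ((∃ D : Vt α, (IsUniv D.1 ∧ (v j).1 ⊆ D.1 ∧ (v j).1 ∉ D.1) ∧ DiagIn α D.1 (v i).1) ∨
      (¬ ∃ D : Vt α, (IsUniv D.1 ∧ (v j).1 ⊆ D.1 ∧ (v j).1 ∉ D.1) ∧
        ∃ b : Vt α, b.1.IsOrdinal ∧ DiagIn α D.1 b.1) ∧ (v i).1 = ∅))) ?_ fun α hα v => ?_
  · repeat' first
      | exact UDef.isOrdinal _
      | exact UDef.eq _ _
      | exact UDef.mem _ _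
      | exact UDef.subset _ _
      | exact UDef.isUniv _
      | exact UDef.diagIn _ _
      | exact UDef.eq_empty _
      | apply UDef.and
      | apply UDef.or
      | apply UDef.ex
      | apply UDef.not
  · generalize v i = y, v j = x
    by_cases hx : x.1.IsOrdinal
    · rw [Subtype.ext_iff (a1 := y) (a2 := fInterp α (laverAt α) x),
        fInterp_of_isOrdinal hx (laverAt_lt hα _)]
      by_cases hy : y.1.IsOrdinal
      · have hxy := eq_laverAt_iff hα x.2 y.2
        rw [hx.toZFSet_rank_eq, hy.toZFSet_rank_eq] at hxy
        rw [← hxy, ← hy.rank_inj (isOrdinal_toZFSet _), rank_toZFSet]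
        tauto
      · simp only [hx, hy, not_true_eq_false, false_and, and_false, or_false, false_iff]
        intro h
        exact hy (h ▸ isOrdinal_toZFSet _)
    · rw [fInterp_of_not_isOrdinal hx]
      tauto

theorem IsUplifting.laver_eq {κ δ : Ordinal.{0}} (hκ : IsUplifting κ) (hδ : δ < κ) :
    laverAt κ δ = laver δ := by
  have hset : ∀ α μ : Ordinal.{0}, (∀ C : Vt α, SetTame (V_ δ) C.1 → C.1 ∈ V_ μ) ↔
      ∀ γ < α, TameStep δ γ → γ < μ := by
    intro α μ
    constructor
    · intro H γ hγ hT
      simpa using H ⟨V_ γ, by simpa using hγ⟩ (setTame_vonNeumann.2 hT)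
    · intro H C hC
      obtain ⟨γ, hT, hC'⟩ := hC.exists_eq
      rw [hC', vonNeumann_mem_vonNeumann_iff]
      exact H γ (by simpa [hC'] using C.2) hT
  have hglobal : ∀ μ < κ, (∀ γ < κ, TameStep δ γ → γ < μ) → ∀ γ, TameStep δ γ → γ < μ := by
    intro μ hμ hb γ hT
    obtain ⟨ρ, hρ, hle, -, e, he⟩ := hκ.2 (γ + 1)
    let v : ℕ → Vt κ := fun n => if n = 0 then ⟨V_ δ, by simpa using hδ⟩
      else ⟨V_ μ, by simpa using hμ⟩
    have key := (UDef.bounded 0 1).absolute hκ.1 hρ (e := e) v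
    simp only [Function.comp_apply, he] at key
    exact (hset ρ μ).1 (key.2 ((hset κ μ).2 hb)) γ ((lt_add_one γ).trans_le hle) hT
  have hlocal : ∀ μ, (∀ γ, TameStep δ γ → γ < μ) → ∃ μ < κ, ∀ γ < κ, TameStep δ γ → γ < μ := by
    intro μ hb
    obtain ⟨ρ, hρ, hle, -, e, he⟩ := hκ.2 (μ + 1)
    let v : ℕ → Vt κ := fun _ => ⟨V_ δ, by simpa using hδ⟩
    have key := (UDef.ex (R := fun α v m => ∀ C : Vt α, SetTame (v 0).1 C.1 → C.1 ∈ m.1)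
      (UDef.bounded 1 0)).absolute hκ.1 hρ (e := e) v
    simp only [Function.comp_apply, he] at key
    obtain ⟨m, hm⟩ := key.1 ⟨⟨V_ μ, by simpa using (lt_add_one μ).trans_le hle⟩,
      (hset ρ μ).2 fun γ _ => hb γ⟩
    refine ⟨m.1.rank, m.2, (hset κ _).1 fun C hC => ?_⟩
    exact mem_vonNeumann.2 (rank_lt_of_mem (hm C hC))
  rw [laverAt, laver]
  by_cases h : IsInaccOrd δ ∧ ∃ μ, ∀ γ, TameStep δ γ → γ < μ
  · obtain ⟨μ, hμ, hb⟩ := hlocal _ h.2.choose_spec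
    rw [dif_pos h, if_pos ⟨h.1, μ, hμ, hb⟩]
    exact diagVal_congr fun γ hT => iff_of_true ((hglobal μ hμ hb γ hT).trans hμ)
      (h.2.choose_spec γ hT)
  · rw [dif_neg h, if_neg]
    rintro ⟨hδ, μ, hμ, hb⟩
    exact h ⟨hδ, μ, hglobal μ hμ hb⟩

/-- There is a class function `L : Ord → Ord` such that for every uplifting cardinal `κ`,
`L` maps `κ` into `κ` and `L ↾ κ` is an ordinal-anticipating uplifting Laver function
for `κ`. -/
theorem global_ordinal_laver_function :
    ∃ F : Ordinal → Ordinal, ∀ κ : Ordinal, IsUplifting κ → OrdLaverFor F κ := by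
  refine ⟨laver, fun κ hκ => ⟨fun δ hδ => ?_, fun β θ => ?_⟩⟩
  · rw [← hκ.laver_eq hδ]
    exact laverAt_lt hκ.1 δ
  · obtain ⟨γ, hθ, hT, hβ⟩ := exists_tameStep_diagVal_eq hκ.exists_tameStep β θ
    obtain ⟨⟨-, hγ, hlt, he⟩, μ, hμ, hb⟩ := id hT
    refine ⟨γ, laverAt γ, hγ, hθ.le, hlt, fun δ _ => laverAt_lt hγ δ,
      fvElem_congr_left (fun δ _ => laverAt_lt hκ.1 δ) (fun δ hδ => hκ.laver_eq hδ)
        (uDefFun_laverAt.fvElem hκ.1 hγ he), ?_⟩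
    rw [laverAt, if_pos ⟨hκ.1, μ, hμ, fun γ' h' hT' => hb γ' h' hT'.1⟩, hβ]

end Paper
end

section
/- A cardinal κ is uplifting if and only if κ is an inaccessible cardinal and there are unboundedly many regular cardinals γ > κ such that V_κ ≺ V_γ. In particular, in the definition of upliftingness the requirement that the target γ be inaccessible may be weakened to requiring only that γ be regular, provided V_κ ≺ V_γ is a proper elementary extension. -/
open FirstOrder Language

universe u

namespace Paper

/-- The atomic formula `xᵢ ∈ xⱼ`. -/
def memFormula {n : ℕ} (i j : Fin n) : LSet.BoundedFormula Empty n :=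
  adj.boundedFormula₂ (Term.var (Sum.inr i)) (Term.var (Sum.inr j))

/-- The atomic formula `xᵢ = xⱼ`. -/
def eqFormula {n : ℕ} (i j : Fin n) : LSet.BoundedFormula Empty n :=
  Term.bdEqual (Term.var (Sum.inr i)) (Term.var (Sum.inr j))

theorem realize_memFormula {α : Ordinal} {n : ℕ} (i j : Fin n) (v : Empty → Vt α)
    (xs : Fin n → Vt α) : (memFormula i j).Realize v xs ↔ (xs i : ZFSet) ∈ (xs j : ZFSet) := by
  simp [memFormula, BoundedFormula.realize_rel₂, Structure.RelMap]

theorem realize_eqFormula {α : Ordinal} {n : ℕ} (i j : Fin n) (v : Empty → Vt α)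
    (xs : Fin n → Vt α) : (eqFormula i j).Realize v xs ↔ (xs i : ZFSet) = (xs j : ZFSet) := by
  simp [eqFormula, Subtype.ext_iff]

/-- The members of `f`, thought of as unordered pairs, witness that the set `y` is the image of
a partial function defined on the set `D`. -/
structure Covers (f D y : ZFSet) : Prop where
  exists_mem : ∀ b ∈ y, ∃ a ∈ D, ∃ p ∈ f, a ∈ p ∧ b ∈ p
  eq_of_mem : ∀ a ∈ D, ∀ b ∈ y, ∀ c ∈ y, ∀ p ∈ f, ∀ q ∈ f,
    a ∈ p → b ∈ p → a ∈ q → c ∈ q → b = c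

/-- The set `y` is linearly ordered by membership. -/
def IsMemChain (y : ZFSet) : Prop :=
  ∀ a ∈ y, ∀ b ∈ y, a ∈ b ∨ a = b ∨ b ∈ a

/-- The formula expressing `Covers x₂ x₀ x₁`. -/
def coversFormula : LSet.BoundedFormula Empty 3 :=
  (∀' (memFormula 3 1 ⟹ ∃' (memFormula 4 0 ⊓
    ∃' (memFormula 5 2 ⊓ (memFormula 4 5 ⊓ memFormula 3 5))))) ⊓
  (∀' (memFormula 3 0 ⟹ ∀' (memFormula 4 1 ⟹ ∀' (memFormula 5 1 ⟹
    ∀' (memFormula 6 2 ⟹ ∀' (memFormula 7 2 ⟹ memFormula 3 6 ⟹ memFormula 4 6 ⟹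
      memFormula 3 7 ⟹ memFormula 5 7 ⟹ eqFormula 4 5))))))

/-- The formula expressing `IsMemChain x₁`. -/
def isMemChainFormula : LSet.BoundedFormula Empty 2 :=
  ∀' (memFormula 2 1 ⟹ ∀' (memFormula 3 1 ⟹
    (memFormula 2 3 ⊔ (eqFormula 2 3 ⊔ memFormula 3 2))))

/-- The sentence expressing that for every set `D` there is a set linearly ordered by membership,
disjoint from `D`, which is not the image of a partial function defined on `D`. -/
def hartogsSentence : LSet.Sentence :=
  ∀' ∃' (isMemChainFormula ⊓ (∀' (memFormula 2 1 ⟹ ∼(memFormula 2 0)) ⊓ ∀' ∼coversFormula))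

theorem rank_lt_of_mem_vt {α : Ordinal} {x : ZFSet} (y : Vt α) (h : x ∈ (y : ZFSet)) :
    x.rank < α :=
  (ZFSet.rank_lt_of_mem h).trans y.2

theorem realize_coversFormula {α : Ordinal} (v : Empty → Vt α) (xs : Fin 3 → Vt α) :
    coversFormula.Realize v xs ↔ Covers (xs 2) (xs 0) (xs 1) := by
  simp only [coversFormula, BoundedFormula.realize_inf, BoundedFormula.realize_all,
    BoundedFormula.realize_ex, BoundedFormula.realize_imp, realize_memFormula, realize_eqFormula]
  constructor
  · rintro ⟨h₁, h₂⟩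
    refine ⟨fun b hb => ?_, fun a ha b hb c hc p hp q hq => ?_⟩
    · obtain ⟨a, ha, p, hp, hap, hbp⟩ := h₁ ⟨b, rank_lt_of_mem_vt _ hb⟩ hb
      exact ⟨a, ha, p, hp, hap, hbp⟩
    · exact h₂ ⟨a, rank_lt_of_mem_vt _ ha⟩ ha ⟨b, rank_lt_of_mem_vt _ hb⟩ hb
        ⟨c, rank_lt_of_mem_vt _ hc⟩ hc ⟨p, rank_lt_of_mem_vt _ hp⟩ hp
        ⟨q, rank_lt_of_mem_vt _ hq⟩ hq
  · rintro ⟨h₁, h₂⟩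
    refine ⟨fun b hb => ?_, fun a ha b hb c hc p hp q hq =>
      h₂ a ha b hb c hc p hp q hq⟩
    obtain ⟨a, ha, p, hp, hap, hbp⟩ := h₁ b hb
    exact ⟨⟨a, rank_lt_of_mem_vt _ ha⟩, ha, ⟨p, rank_lt_of_mem_vt _ hp⟩, hp, hap, hbp⟩

theorem realize_isMemChainFormula {α : Ordinal} (v : Empty → Vt α) (xs : Fin 2 → Vt α) :
    isMemChainFormula.Realize v xs ↔ IsMemChain (xs 1) := by
  simp only [isMemChainFormula, BoundedFormula.realize_sup, BoundedFormula.realize_all,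
    BoundedFormula.realize_imp, realize_memFormula, realize_eqFormula]
  exact ⟨fun h a ha b hb => h ⟨a, rank_lt_of_mem_vt _ ha⟩ ha ⟨b, rank_lt_of_mem_vt _ hb⟩ hb,
    fun h a ha b hb => h a ha b hb⟩

theorem realize_hartogsSentence {α : Ordinal} :
    Vt α ⊨ hartogsSentence ↔ ∀ D : ZFSet, D.rank < α → ∃ y : ZFSet, y.rank < α ∧ IsMemChain y ∧
      (∀ b ∈ y, b ∉ D) ∧ ∀ f : ZFSet, f.rank < α → ¬ Covers f D y := by
  simp only [hartogsSentence, Sentence.Realize, Formula.Realize, BoundedFormula.realize_inf,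
    BoundedFormula.realize_all, BoundedFormula.realize_ex, BoundedFormula.realize_imp,
    BoundedFormula.realize_not, realize_memFormula, realize_coversFormula,
    realize_isMemChainFormula]
  constructor
  · intro h D hD
    obtain ⟨y, hy, hdisj, hf⟩ := h ⟨D, hD⟩
    exact ⟨y, y.2, hy, fun b hb => hdisj ⟨b, rank_lt_of_mem_vt y hb⟩ hb,
      fun f hfα => hf ⟨f, hfα⟩⟩
  · intro h D
    obtain ⟨y, hyα, hy, hdisj, hf⟩ := h D D.2
    exact ⟨⟨y, hyα⟩, hy, fun b hb => hdisj b hb, fun f => hf f f.2⟩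

theorem Covers.card_le {f D y : ZFSet.{u}} (h : Covers f D y) : y.card ≤ D.card := by
  choose a haD p hpf hap hbp using h.exists_mem
  rw [← Cardinal.lift_le.{u + 1}, ← ZFSet.cardinalMk_coe_sort, ← ZFSet.cardinalMk_coe_sort]
  refine Cardinal.mk_le_of_injective (f := fun b : y => (⟨a b b.2, haD b b.2⟩ : D)) ?_
  intro b c hbc
  have hac : a b b.2 = a c c.2 := congrArg Subtype.val hbc
  exact Subtype.ext <| h.eq_of_mem _ (haD b b.2) b b.2 c c.2 _ (hpf b b.2) _ (hpf c c.2)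
    (hap b b.2) (hbp b b.2) (hac ▸ hap c c.2) (hbp c c.2)

/-- If `y` is disjoint from `D` and no larger than `D`, some covering of `y` by `D` has rank
at most one more than the rank of `D ∪ y`. -/
theorem exists_covers {D y : ZFSet.{u}} (hdisj : ∀ b ∈ y, b ∉ D) (hcard : y.card ≤ D.card) :
    ∃ f : ZFSet, f.rank ≤ Order.succ (max D.rank y.rank) ∧ Covers f D y := by
  rw [← Cardinal.lift_le.{u + 1}, ← ZFSet.cardinalMk_coe_sort, ← ZFSet.cardinalMk_coe_sort] at hcard
  obtain ⟨g⟩ := hcard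
  refine ⟨ZFSet.sep (fun p => ∃ b : y, p = {(g b : ZFSet), (b : ZFSet)}) (D ∪ y).powerset,
    ?_, ?_, ?_⟩
  · rw [← ZFSet.rank_union, ← ZFSet.rank_powerset]
    exact ZFSet.rank_mono ZFSet.sep_subset
  · intro b hb
    refine ⟨g ⟨b, hb⟩, (g ⟨b, hb⟩).2, {(g ⟨b, hb⟩ : ZFSet), b}, ?_, by simp, by simp⟩
    rw [ZFSet.mem_sep, ZFSet.mem_powerset]
    refine ⟨fun z hz => ?_, ⟨b, hb⟩, rfl⟩
    rcases ZFSet.mem_pair.1 hz with rfl | rfl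
    · exact ZFSet.mem_union.2 (.inl (g ⟨b, hb⟩).2)
    · exact ZFSet.mem_union.2 (.inr hb)
  · have key : ∀ a ∈ D, ∀ b, ∀ hb : b ∈ y, ∀ d : y, a ∈ ({(g d : ZFSet), (d : ZFSet)} : ZFSet) →
        b ∈ ({(g d : ZFSet), (d : ZFSet)} : ZFSet) → a = g ⟨b, hb⟩ := by
      intro a ha b hb d had hbd
      rcases ZFSet.mem_pair.1 hbd with rfl | rfl
      · exact absurd (g d).2 (hdisj _ hb)
      · rcases ZFSet.mem_pair.1 had with rfl | rfl
        · rfl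
        · exact absurd ha (hdisj _ hb)
    intro a ha b hb c hc p hp q hq hap hbp haq hcq
    obtain ⟨-, d, rfl⟩ := ZFSet.mem_sep.1 hp
    obtain ⟨-, e, rfl⟩ := ZFSet.mem_sep.1 hq
    have hgg := (key a ha b hb d hap hbp).symm.trans (key a ha c hc e haq hcq)
    exact congrArg Subtype.val (g.injective (Subtype.ext hgg))

theorem IsMemChain.card_le {y : ZFSet.{u}} (h : IsMemChain y) : y.card ≤ y.rank.card := by
  rw [← Cardinal.lift_le.{u + 1}, ← ZFSet.cardinalMk_coe_sort, ← Cardinal.mk_Iio_ordinal]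
  refine Cardinal.mk_le_of_injective
    (f := fun b : y => (⟨b.1.rank, ZFSet.rank_lt_of_mem b.2⟩ : Set.Iio y.rank)) ?_
  intro b c hbc
  have hr : b.1.rank = c.1.rank := congrArg Subtype.val hbc
  rcases h b b.2 c c.2 with hb | hb | hb
  · exact absurd (ZFSet.rank_lt_of_mem hb) hr.not_lt
  · exact Subtype.ext hb
  · exact absurd (ZFSet.rank_lt_of_mem hb) hr.not_gt

theorem isMemChain_of_subset_toZFSet {y : ZFSet} {o : Ordinal} (h : y ⊆ o.toZFSet) :
    IsMemChain y := fun _ ha _ hb =>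
  ((ZFSet.isOrdinal_toZFSet o).mem (h ha)).mem_trichotomous ((ZFSet.isOrdinal_toZFSet o).mem (h hb))

theorem realize_hartogsSentence_of_isInaccOrd {κ : Ordinal} (hκ : IsInaccOrd κ) :
    Vt κ ⊨ hartogsSentence := by
  obtain ⟨hinacc, hord⟩ := hκ
  rw [realize_hartogsSentence]
  intro D hD
  set c := max D.card Cardinal.aleph0
  have hDc : D.card < κ.card := by
    have hsub : D ⊆ ZFSet.vonNeumann D.rank := ZFSet.subset_vonNeumann_self D
    have hlt := Cardinal.preBeth_strictMono hD
    rw [← hord, hinacc.preBeth_ord] at hlt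
    exact (ZFSet.card_mono hsub).trans_lt (by rwa [ZFSet.card_vonNeumann])
  have hcκ : c < κ.card := max_lt hDc hinacc.aleph0_lt
  have hsucc : (Order.succ c).ord < κ := by
    rw [← hord, Cardinal.ord_lt_ord]
    exact (Order.succ_le_of_lt (Cardinal.cantor c)).trans_lt (hinacc.isStrongPrelimit hcκ)
  set y := ZFSet.sep (· ∉ D) (Order.succ c).ord.toZFSet
  have hy : y ⊆ (Order.succ c).ord.toZFSet := ZFSet.sep_subset
  refine ⟨y, ?_, isMemChain_of_subset_toZFSet hy, fun b hb => (ZFSet.mem_sep.1 hb).2, ?_⟩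
  · exact (ZFSet.rank_mono hy).trans_lt (by rwa [Ordinal.rank_toZFSet])
  · intro f _ hf
    have hunion : (Order.succ c).ord.toZFSet ⊆ y ∪ D := fun z hz => by
      by_cases hzD : z ∈ D
      · exact ZFSet.mem_union.2 (.inr hzD)
      · exact ZFSet.mem_union.2 (.inl (ZFSet.mem_sep.2 ⟨hz, hzD⟩))
    have hle : Order.succ c ≤ c := calc
      Order.succ c = (Order.succ c).ord.toZFSet.card := by simp
      _ ≤ y.card + D.card := (ZFSet.card_mono hunion).trans ZFSet.card_union_le
      _ ≤ c + c := add_le_add (hf.card_le.trans (le_max_left _ _)) (le_max_left _ _)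
      _ = c := Cardinal.add_eq_self (le_max_right _ _)
    exact (Order.lt_succ c).not_ge hle

theorem isStrongPrelimit_of_realize_hartogsSentence {γ : Ordinal} (hγ : IsRegularOrd γ)
    (h : Vt γ ⊨ hartogsSentence) : γ.card.IsStrongPrelimit := by
  obtain ⟨hreg, hord⟩ := hγ
  have hlim : Order.IsSuccLimit γ := hord ▸ Cardinal.isSuccLimit_ord hreg.aleph0_le
  rw [realize_hartogsSentence] at h
  intro x hx
  by_contra! hle
  have hD : x.ord.toZFSet.powerset.rank < γ := by
    rw [ZFSet.rank_powerset, Ordinal.rank_toZFSet]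
    exact hlim.succ_lt (by rwa [← hord, Cardinal.ord_lt_ord])
  obtain ⟨y, hy, hchain, hdisj, hf⟩ := h _ hD
  have hyc : y.card ≤ x.ord.toZFSet.powerset.card := calc
    y.card ≤ y.rank.card := hchain.card_le
    _ ≤ γ.card := Ordinal.card_le_card hy.le
    _ ≤ x.ord.toZFSet.powerset.card := by simpa using hle
  obtain ⟨f, hfr, hcov⟩ := exists_covers hdisj hyc
  exact hf f (hfr.trans_lt (hlim.succ_lt (max_lt hD hy))) hcov

/-- A regular target of a proper elementary extension of `V_κ`, with `κ` inaccessible, is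
inaccessible. -/
theorem IsRegularOrd.isInaccOrd_of_vElem {κ γ : Ordinal} (hκ : IsInaccOrd κ)
    (hγ : IsRegularOrd γ) (hlt : κ < γ) (he : VElem κ γ) : IsInaccOrd γ := by
  obtain ⟨e, -⟩ := he
  have hγs := (e.map_sentence hartogsSentence).1 (realize_hartogsSentence_of_isInaccOrd hκ)
  exact ⟨⟨hκ.1.aleph0_lt.trans_le (Ordinal.card_le_card hlt.le), hγ.1.2,
    isStrongPrelimit_of_realize_hartogsSentence hγ hγs⟩, hγ.2⟩

/-- A cardinal `κ` is uplifting if and only if it is inaccessible and there are unboundedly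
many regular cardinals `γ > κ` with `V_κ ≺ V_γ`: in the definition of upliftingness the
requirement that the target be inaccessible may be weakened to regularity. -/
theorem uplifting_iff_unboundedly_many_regular_targets (κ : Ordinal) :
    IsUplifting κ ↔
      (IsInaccOrd κ ∧
        ∀ θ : Ordinal, ∃ γ : Ordinal, IsRegularOrd γ ∧ θ ≤ γ ∧ κ < γ ∧ VElem κ γ) := by
  refine and_congr_right fun hκ => forall_congr' fun θ => exists_congr fun γ => ?_
  constructor
  · rintro ⟨hγ, h⟩
    exact ⟨⟨hγ.1.isRegular, hγ.2⟩, h⟩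
  · rintro ⟨hγ, hθ, hlt, he⟩
    exact ⟨hγ.isInaccOrd_of_vElem hκ hlt he, hθ, hlt, he⟩

end Paper
end
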